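/- Fix an integer k ≥ 2. Let |𝒢_n| be the number of vertices of the giant (the largest closed strongly connected component) of the random k-out digraph 𝒟_{n,k}. Then (|𝒢_n| − ν_k n)/(σ_k √n) converges in distribution to a standard normal random variable as n → ∞; that is, for every x ∈ ℝ, P((|𝒢_n| − ν_k n)/(σ_k √n) ≤ x) → (1/√(2π)) ∫_{−∞}^x e^{−t²/2} dt. -/

import Mathlib

open scoped Classical
open Filter MeasureTheory

/-- Probability of an event under the uniform random `k`-out digraph model `𝒟_{n,k}`:
a uniformly random function `f : [n] × [k] → [n]`. -/
noncomputable def prob (n k : ℕ) (P : (Fin n × Fin k → Fin n) → Prop) : ℝ :=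
  ((Finset.univ.filter P).card : ℝ) / (Fintype.card (Fin n × Fin k → Fin n) : ℝ)

/-- One arc step: there is a labeled arc from `u` to `v`. -/
def Step {n k : ℕ} (f : Fin n × Fin k → Fin n) (u v : Fin n) : Prop :=
  ∃ i : Fin k, f (u, i) = v

/-- `u` reaches `v` by following finitely many arcs. -/
def Reaches {n k : ℕ} (f : Fin n × Fin k → Fin n) : Fin n → Fin n → Prop :=
  Relation.ReflTransGen (Step f)

/-- A set of vertices is closed if no arc leaves it. -/
def IsClosedSet {n k : ℕ} (f : Fin n × Fin k → Fin n) (S : Set (Fin n)) : Prop :=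
  ∀ v ∈ S, ∀ i : Fin k, f (v, i) ∈ S

/-- A set of vertices is strongly connected if it is nonempty and
any two of its vertices reach each other. -/
def IsStrConn {n k : ℕ} (f : Fin n × Fin k → Fin n) (S : Set (Fin n)) : Prop :=
  S.Nonempty ∧ ∀ u ∈ S, ∀ v ∈ S, Reaches f u v

/-- `G` is the giant: a closed strongly connected set of maximum size,
ties broken by choosing the one containing the smallest vertex label. -/
def IsGiant {n k : ℕ} (f : Fin n × Fin k → Fin n) (G : Set (Fin n)) : Prop :=
  IsClosedSet f G ∧ IsStrConn f G ∧
    (∀ S : Set (Fin n), IsClosedSet f S → IsStrConn f S → S.ncard ≤ G.ncard) ∧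
    (∀ S : Set (Fin n), IsClosedSet f S → IsStrConn f S → S.ncard = G.ncard →
      ∃ v ∈ G, ∀ u ∈ S, v ≤ u)

/-- Resampling one coordinate of a uniformly random function leaves its law unchanged. -/
lemma sum_update_eq {α β M : Type*} [Fintype α] [Fintype β] [DecidableEq α] [AddCommMonoid M]
    (a : α) (F : (α → β) → M) :
    ∑ x, ∑ y, F (Function.update x a y) = Fintype.card β • ∑ x, F x := by
  have hinv : Function.Involutive
      (fun p : (α → β) × β => ((Function.update p.1 a p.2, p.1 a) : (α → β) × β)) := by
    rintro ⟨x, y⟩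
    simp
  rw [← Fintype.sum_prod_type' (f := fun x y => F (Function.update x a y)),
    hinv.bijective.sum_comp (g := fun p : (α → β) × β => F p.1), Fintype.sum_prod_type]
  simp [Finset.smul_sum]

/-- The number of values of `Fin n` that lie neither in `D` nor among the entries of `x` indexed
by `A`. -/
noncomputable def unseen {α : Type*} {n : ℕ} (D : Finset (Fin n)) (A : Finset α)
    (x : α → Fin n) : ℝ :=
  n - (D ∪ A.image x).card

section Unseen

variable {α : Type*} {n : ℕ} {D : Finset (Fin n)}

lemma unseen_nonneg (A : Finset α) (x : α → Fin n) : 0 ≤ unseen D A x := by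
  have h : (D ∪ A.image x).card ≤ n := by simpa using Finset.card_le_univ (D ∪ A.image x)
  have h' : ((D ∪ A.image x).card : ℝ) ≤ n := by exact_mod_cast h
  unfold unseen; linarith

lemma unseen_le (A : Finset α) (x : α → Fin n) : unseen D A x ≤ n := by
  unfold unseen
  have : (0 : ℝ) ≤ (D ∪ A.image x).card := by positivity
  linarith

lemma unseen_update [DecidableEq α] {A : Finset α} {a : α} (ha : a ∉ A) (x : α → Fin n)
    (y : Fin n) : unseen D A (Function.update x a y) = unseen D A x := by
  unfold unseen
  congr 3
  congr 1
  refine Finset.image_congr fun b hb => ?_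
  exact Function.update_of_ne (by rintro rfl; exact ha hb) _ _

lemma unseen_empty (x : α → Fin n) : unseen D ∅ x = n - D.card := by simp [unseen]

variable [Fintype α] [DecidableEq α]

/-- Revealing one more entry turns an unseen value into a seen one with probability
`unseen / n`. -/
lemma sum_unseen_insert {E : Type*} [AddCommGroup E] [Module ℝ E] (hn : 0 < n)
    {A : Finset α} {a : α} (ha : a ∉ A)
    (w : (α → Fin n) → ℝ) (hw : ∀ x y, w (Function.update x a y) = w x) (g : ℝ → E) :
    ∑ x, w x • g (unseen D (insert a A) x) =
      ∑ x, w x • ((unseen D A x / n) • g (unseen D A x - 1) +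
        (1 - unseen D A x / n) • g (unseen D A x)) := by
  have hn' : (n : ℝ) ≠ 0 := by positivity
  have key : ∀ x, ∑ y, w (Function.update x a y) •
      g (unseen D (insert a A) (Function.update x a y)) =
      (n : ℝ) • (w x • ((unseen D A x / n) • g (unseen D A x - 1) +
        (1 - unseen D A x / n) • g (unseen D A x))) := by
    intro x
    have himg : ∀ y, D ∪ (insert a A).image (Function.update x a y) =
        insert y (D ∪ A.image x) := by
      intro y
      rw [Finset.image_insert, Function.update_self, Finset.union_insert]
      congr 2
      exact Finset.image_congr fun b hb => Function.update_of_ne (by rintro rfl; exact ha hb) _ _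
    have hval : ∀ y, unseen D (insert a A) (Function.update x a y) =
        if y ∈ D ∪ A.image x then unseen D A x else unseen D A x - 1 := by
      intro y
      unfold unseen
      rw [himg]
      split_ifs with h
      · rw [Finset.insert_eq_of_mem h]
      · rw [Finset.card_insert_of_notMem h]; push_cast; ring
    simp only [hw, hval, ← Finset.smul_sum]
    rw [smul_comm]
    congr 1
    have hs : ∀ y, g (if y ∈ D ∪ A.image x then unseen D A x else unseen D A x - 1) =
        if y ∈ D ∪ A.image x then g (unseen D A x) else g (unseen D A x - 1) := by
      intro y; split_ifs <;> rfl
    simp only [hs]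
    rw [Finset.sum_ite, Finset.sum_const, Finset.sum_const, smul_add, smul_smul, smul_smul,
      mul_sub, mul_div_cancel₀ _ hn', add_comm]
    have h1 : (Finset.univ.filter fun y => y ∈ D ∪ A.image x).card = (D ∪ A.image x).card := by
      congr 1; ext; simp
    have h2 : ((Finset.univ.filter fun y => y ∉ D ∪ A.image x).card : ℝ) = unseen D A x := by
      rw [Finset.filter_not, Finset.card_sdiff_of_subset (Finset.filter_subset _ _),
        Nat.cast_sub (Finset.card_le_card (Finset.filter_subset _ _)), h1]
      simp [unseen]
    have h3 : ((Finset.univ.filter fun y => y ∈ D ∪ A.image x).card : ℝ) =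
        n * 1 - unseen D A x := by
      rw [h1]; simp [unseen]
    rw [← h3, ← h2, Nat.cast_smul_eq_nsmul, Nat.cast_smul_eq_nsmul]
  have h := sum_update_eq a (fun x => w x • g (unseen D (insert a A) x))
  simp only [key, ← Finset.smul_sum, Fintype.card_fin] at h
  rw [← Nat.cast_smul_eq_nsmul ℝ] at h
  exact (smul_right_injective E hn' h).symm

/-- Conditionally on the entries indexed by `A`, the number of unseen values after revealing
the entries indexed by `B` has variance at most `|B| / 4`. -/
lemma sum_unseen_sub_sq_le (hn : 0 < n) {A B : Finset α} (hAB : Disjoint A B) (c : ℝ)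
    (w : (α → Fin n) → ℝ) (hw0 : ∀ x, 0 ≤ w x)
    (hw : ∀ a ∉ A, ∀ x y, w (Function.update x a y) = w x)
    (hc : ∀ x, w x ≠ 0 → unseen D A x = c) :
    ∑ x, w x * (unseen D (A ∪ B) x - c * (1 - 1 / n) ^ B.card) ^ 2 ≤ B.card / 4 * ∑ x, w x := by
  have hn' : (0 : ℝ) < n := by positivity
  have hn1 : (1 : ℝ) ≤ n := by exact_mod_cast hn
  induction B using Finset.induction_on with
  | empty =>
    apply le_of_eq
    simp only [Finset.union_empty, Finset.card_empty, pow_zero, mul_one, CharP.cast_eq_zero,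
      zero_div, zero_mul]
    refine Finset.sum_eq_zero fun x _ => ?_
    by_cases h : w x = 0
    · simp [h]
    · simp [hc x h]
  | insert a B haB ih =>
    rw [Finset.disjoint_insert_right] at hAB
    have ha : a ∉ A ∪ B := by simp [hAB.1, haB]
    have := sum_unseen_insert (D := D) hn ha w (hw a hAB.1)
      (fun t => (t - c * (1 - 1 / n : ℝ) ^ (insert a B).card) ^ 2)
    simp only [smul_eq_mul] at this
    rw [Finset.union_insert, this, Finset.card_insert_of_notMem haB]
    have ih' := ih hAB.2
    set m := c * (1 - 1 / n : ℝ) ^ B.card with hm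
    have hm' : c * (1 - 1 / n : ℝ) ^ (B.card + 1) = m * (1 - 1 / n) := by rw [hm]; ring
    rw [hm']
    calc _ ≤ ∑ x, (w x * (unseen D (A ∪ B) x - m) ^ 2 + w x * (1 / 4)) := by
          refine Finset.sum_le_sum fun x _ => ?_
          rw [← mul_add]
          refine mul_le_mul_of_nonneg_left ?_ (hw0 x)
          set U := unseen D (A ∪ B) x
          have e : U / n * (U - 1 - m * (1 - 1 / n)) ^ 2 + (1 - U / n) * (U - m * (1 - 1 / n)) ^ 2
              = (1 - 1 / n) ^ 2 * (U - m) ^ 2 + (U / n) * (1 - U / n) := by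
            field_simp; ring
          rw [e]
          have hq : (1 - 1 / n : ℝ) ^ 2 ≤ 1 := by
            have h1 : (1 : ℝ) / n ≤ 1 := by rw [div_le_one hn']; exact hn1
            have h2 : (0 : ℝ) ≤ 1 / n := by positivity
            nlinarith
          nlinarith [sq_nonneg (U - m), sq_nonneg (U / n - 1 / 2)]
      _ ≤ _ := by
          rw [Finset.sum_add_distrib, ← Finset.sum_mul]
          push_cast
          linarith

end Unseen

lemma norm_exp_I_mul_sub_le (x : ℝ) :
    ‖Complex.exp (Complex.I * x) - (1 + Complex.I * x - x ^ 2 / 2)‖ ≤ 4 * |x| ^ 3 := by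
  have hx : ‖Complex.I * (x : ℂ)‖ = |x| := by simp
  rcases le_or_gt |x| 1 with h | h
  · have := Complex.exp_bound (x := Complex.I * x) (by rw [hx]; exact h) (n := 3) (by norm_num)
    rw [hx] at this
    have e : ∑ m ∈ Finset.range 3, (Complex.I * (x : ℂ)) ^ m / (m.factorial : ℂ) =
        1 + Complex.I * x - x ^ 2 / 2 := by
      simp [Finset.sum_range_succ, mul_pow]; ring
    rw [e] at this
    refine this.trans ?_
    norm_num [Nat.factorial]
    nlinarith [pow_nonneg (abs_nonneg x) 3]
  · have h1 : ‖Complex.exp (Complex.I * x)‖ = 1 := by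
      rw [mul_comm]; exact Complex.norm_exp_ofReal_mul_I x
    have h2 : ‖(1 + Complex.I * x - x ^ 2 / 2 : ℂ)‖ ≤ 1 + |x| + |x| ^ 2 / 2 := by
      refine (norm_sub_le _ _).trans (add_le_add ((norm_add_le _ _).trans ?_) ?_)
      · rw [hx]; simp
      · simp
    refine (norm_sub_le _ _).trans ?_
    rw [h1]
    have h3 : |x| ≤ |x| ^ 3 := le_self_pow₀ h.le (by norm_num)
    have h4 : |x| ^ 2 ≤ |x| ^ 3 := pow_le_pow_right₀ h.le (by norm_num)
    linarith

lemma abs_exp_neg_sub_le {y : ℝ} (hy : 0 ≤ y) : |Real.exp (-y) - (1 - y)| ≤ y ^ 2 := by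
  have h1 := Real.add_one_le_exp (-y)
  have h2 := Real.add_one_le_exp y
  rw [abs_of_nonneg (by linarith)]
  have h3 : Real.exp (-y) * Real.exp y = 1 := by rw [← Real.exp_add]; simp
  have h4 := Real.exp_pos (-y)
  have h5 : Real.exp (-y) * (y + 1) ≤ 1 := by nlinarith
  rcases le_or_gt y 1 with h | h
  · have : Real.exp (-y) * (y + 1) ≤ (1 - y + y ^ 2) * (y + 1) := by nlinarith [pow_nonneg hy 3]
    have := le_of_mul_le_mul_right this (by linarith)
    linarith
  · have : Real.exp (-y) ≤ 1 := by rw [Real.exp_le_one_iff]; linarith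
    nlinarith

/-- Second-order expansion of the characteristic function of a centered Bernoulli variable. -/
lemma norm_bernoulli_charFun_sub_le {p u : ℝ} (hp0 : 0 ≤ p) (hp1 : p ≤ 1) (hu0 : 0 ≤ u)
    (hu1 : u ≤ 1) (θ : ℝ) :
    ‖(p : ℂ) * Complex.exp (Complex.I * (-(θ * (1 - p)) : ℝ)) +
        ((1 - p : ℝ) : ℂ) * Complex.exp (Complex.I * (θ * p : ℝ)) -
        (Real.exp (-(θ ^ 2 * (u * (1 - u)) / 2)) : ℂ)‖ ≤
      |θ| ^ 3 + θ ^ 4 + θ ^ 2 * |p - u| := by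
  have h1 := norm_exp_I_mul_sub_le (-(θ * (1 - p)))
  have h2 := norm_exp_I_mul_sub_le (θ * p)
  have huu : 0 ≤ u * (1 - u) := mul_nonneg hu0 (by linarith)
  have huu' : u * (1 - u) ≤ 1 := by nlinarith
  have h3 := abs_exp_neg_sub_le (y := θ ^ 2 * (u * (1 - u)) / 2) (by positivity)
  have h4 : (θ ^ 2 * (u * (1 - u)) / 2) ^ 2 ≤ θ ^ 4 := by
    have : (u * (1 - u)) ^ 2 ≤ 1 := pow_le_one₀ huu huu'
    nlinarith [sq_nonneg (θ ^ 2)]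
  have h5 : |p * (1 - p) - u * (1 - u)| ≤ |p - u| := by
    have : p * (1 - p) - u * (1 - u) = (p - u) * (1 - p - u) := by ring
    rw [this, abs_mul]
    refine mul_le_of_le_one_right (abs_nonneg _) ?_
    rw [abs_le]; constructor <;> linarith
  set a := Complex.exp (Complex.I * (-(θ * (1 - p)) : ℝ))
  set b := Complex.exp (Complex.I * (θ * p : ℝ))
  set e := Real.exp (-(θ ^ 2 * (u * (1 - u)) / 2))
  have split : (p : ℂ) * a + ((1 - p : ℝ) : ℂ) * b - (e : ℂ) =
      p * (a - (1 + Complex.I * (-(θ * (1 - p)) : ℝ) - ((-(θ * (1 - p)) : ℝ) : ℂ) ^ 2 / 2)) +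
      ((1 - p : ℝ) : ℂ) * (b - (1 + Complex.I * (θ * p : ℝ) - ((θ * p : ℝ) : ℂ) ^ 2 / 2)) +
      (((-(θ ^ 2) / 2 * (p * (1 - p) - u * (1 - u)) : ℝ) : ℂ) -
        ((e - (1 - θ ^ 2 * (u * (1 - u)) / 2) : ℝ) : ℂ)) := by
    push_cast; ring
  rw [split]
  refine (norm_add_le _ _).trans ?_
  refine (add_le_add (norm_add_le _ _) (norm_sub_le _ _)).trans ?_
  rw [norm_mul, norm_mul, Complex.norm_real, Complex.norm_real, Complex.norm_real,
    Complex.norm_real, Real.norm_eq_abs, Real.norm_eq_abs, Real.norm_eq_abs, Real.norm_eq_abs,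
    abs_of_nonneg hp0, abs_of_nonneg (show 0 ≤ 1 - p by linarith)]
  have e1 : p * ‖a - (1 + Complex.I * (-(θ * (1 - p)) : ℝ) -
      ((-(θ * (1 - p)) : ℝ) : ℂ) ^ 2 / 2)‖ ≤ p * (4 * (|θ| ^ 3 * (1 - p) ^ 3)) := by
    refine mul_le_mul_of_nonneg_left (h1.trans ?_) hp0
    rw [abs_neg, abs_mul, mul_pow, abs_of_nonneg (show 0 ≤ 1 - p by linarith)]
  have e2 : (1 - p) * ‖b - (1 + Complex.I * (θ * p : ℝ) - ((θ * p : ℝ) : ℂ) ^ 2 / 2)‖ ≤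
      (1 - p) * (4 * (|θ| ^ 3 * p ^ 3)) := by
    refine mul_le_mul_of_nonneg_left (h2.trans ?_) (by linarith)
    rw [abs_mul, mul_pow, abs_of_nonneg hp0]
  have e3 : |-(θ ^ 2) / 2 * (p * (1 - p) - u * (1 - u))| ≤ θ ^ 2 * |p - u| := by
    rw [abs_mul, abs_div, abs_neg, abs_of_nonneg (sq_nonneg θ), abs_two]
    nlinarith [abs_nonneg (p - u), mul_le_mul_of_nonneg_left h5 (sq_nonneg θ),
      mul_nonneg (sq_nonneg θ) (abs_nonneg (p - u))]
  have e4 : p * (4 * (|θ| ^ 3 * (1 - p) ^ 3)) + (1 - p) * (4 * (|θ| ^ 3 * p ^ 3)) ≤ |θ| ^ 3 := by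
    have : p * (4 * (|θ| ^ 3 * (1 - p) ^ 3)) + (1 - p) * (4 * (|θ| ^ 3 * p ^ 3)) =
      |θ| ^ 3 * (4 * (p * (1 - p)) * (1 - 2 * (p * (1 - p)))) := by ring
    rw [this]
    refine mul_le_of_le_one_right (by positivity) ?_
    have : 0 ≤ p * (1 - p) := mul_nonneg hp0 (by linarith)
    have : p * (1 - p) ≤ 1 / 4 := by nlinarith [sq_nonneg (p - 1 / 2)]
    nlinarith
  linarith [h3.trans h4]

/-- The asymptotic variance of the number of unseen values after `t` uniform draws from `n`
values. -/
noncomputable def unseenVar (n : ℕ) (t : ℕ) : ℝ :=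
  n * (1 - 1 / n : ℝ) ^ t - (n + t) * (1 - 1 / n : ℝ) ^ (2 * t)

section CharFun

variable {α : Type*} [Fintype α] [DecidableEq α] {n : ℕ} {D : Finset (Fin n)}

/-- Quantitative central limit theorem for the number of unseen values, in terms of
characteristic functions. -/
lemma norm_sum_exp_unseen_sub_le (hn : 0 < n) (hD : D.card = 1) (A : Finset α) (θ : ℝ) :
    ‖∑ x : α → Fin n, Complex.exp (Complex.I *
        (θ * (unseen D A x - n * (1 - 1 / n) ^ (A.card + 1)) : ℝ)) -
        (Fintype.card (α → Fin n) : ℂ) * (Real.exp (-(θ ^ 2 * unseenVar n A.card / 2)) : ℂ)‖ ≤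
      Fintype.card (α → Fin n) *
        (A.card * (|θ| ^ 3 + θ ^ 4 + θ ^ 2 * (√A.card / n))) := by
  have hn' : (0 : ℝ) < n := by positivity
  have hn1 : (1 : ℝ) ≤ n := by exact_mod_cast hn
  have hq0 : (0 : ℝ) ≤ 1 - 1 / n := by
    have : (1 : ℝ) / n ≤ 1 := by rw [div_le_one hn']; exact hn1
    linarith
  have hq1 : (1 - 1 / n : ℝ) ≤ 1 := by
    have : (0 : ℝ) ≤ 1 / n := by positivity
    linarith
  induction A using Finset.induction_on generalizing θ with
  | empty =>
    have : (n : ℝ) * (1 - 1 / n) = n - 1 := by field_simp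
    simp [unseen_empty, hD, unseenVar, -one_div, this]
  | insert a A ha ih =>
    set q : ℝ := 1 - 1 / n with hq
    set t := A.card with ht
    set m : ℝ := n * q ^ (t + 1) with hm
    set u : ℝ := q ^ (t + 1) with hu
    have hu0 : 0 ≤ u := by positivity
    have hu1 : u ≤ 1 := pow_le_one₀ hq0 hq1
    set K : ℝ := ((Fintype.card (α → Fin n) : ℕ) : ℝ) with hK
    have hstep := sum_unseen_insert (D := D) hn ha (fun _ => (1 : ℝ)) (fun _ _ => rfl)
      (fun z => Complex.exp (Complex.I * (θ * (z - n * q ^ ((insert a A).card + 1)) : ℝ)))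
    simp only [one_smul] at hstep
    rw [hstep, Finset.card_insert_of_notMem ha, ← ht]
    have hvar : unseenVar n (t + 1) = q ^ 2 * unseenVar n t + u * (1 - u) := by
      simp only [unseenVar, hu, ← hq]
      have : (n : ℝ) * (1 - q) = 1 := by rw [hq]; field_simp; ring
      push_cast
      linear_combination (q ^ (t + 1)) * this
    have hprod : Real.exp (-(θ ^ 2 * unseenVar n (t + 1) / 2)) =
        Real.exp (-(θ ^ 2 * (u * (1 - u)) / 2)) *
          Real.exp (-((θ * q) ^ 2 * unseenVar n t / 2)) := by
      rw [← Real.exp_add, hvar]; ring_nf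
    set c : ℝ := Real.exp (-(θ ^ 2 * (u * (1 - u)) / 2)) with hc
    have hc0 : 0 ≤ c := (Real.exp_pos _).le
    have hc1 : c ≤ 1 := by
      rw [hc, Real.exp_le_one_iff]
      have : 0 ≤ u * (1 - u) := mul_nonneg hu0 (by linarith)
      have : 0 ≤ θ ^ 2 * (u * (1 - u)) := by positivity
      linarith
    have hterm : ∀ x : α → Fin n,
        (unseen D A x / n) • Complex.exp (Complex.I *
            (θ * (unseen D A x - 1 - n * q ^ (t + 1 + 1)) : ℝ)) +
          (1 - unseen D A x / n) • Complex.exp (Complex.I *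
            (θ * (unseen D A x - n * q ^ (t + 1 + 1)) : ℝ)) =
        c * Complex.exp (Complex.I * (θ * q * (unseen D A x - m) : ℝ)) +
        Complex.exp (Complex.I * (θ * q * (unseen D A x - m) : ℝ)) *
          (((unseen D A x / n : ℝ) : ℂ) *
              Complex.exp (Complex.I * (-(θ * (1 - unseen D A x / n)) : ℝ)) +
            ((1 - unseen D A x / n : ℝ) : ℂ) *
              Complex.exp (Complex.I * (θ * (unseen D A x / n) : ℝ)) - (c : ℂ)) := by
      intro x
      set U := unseen D A x
      have hqU : q * U = U - U / n := by rw [hq]; ring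
      have e1 : θ * (U - 1 - n * q ^ (t + 1 + 1)) =
          θ * q * (U - m) + -(θ * (1 - U / n)) := by
        rw [hm]; linear_combination (-θ) * hqU
      have e2 : θ * (U - n * q ^ (t + 1 + 1)) = θ * q * (U - m) + θ * (U / n) := by
        rw [hm]; linear_combination (-θ) * hqU
      rw [e1, e2]
      simp only [Complex.ofReal_add, mul_add, Complex.exp_add, Complex.real_smul]
      ring
    rw [Finset.sum_congr rfl fun x _ => hterm x, Finset.sum_add_distrib, ← Finset.mul_sum, hprod]
    have hvarbound : ∑ x : α → Fin n, |unseen D A x / n - u| ≤ K * (√t / n) := by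
      have hcheb := sum_unseen_sub_sq_le (D := D) hn (A := (∅ : Finset α)) (B := A) (by simp)
        (n - 1) (fun _ => (1 : ℝ)) (fun _ => zero_le_one) (fun _ _ _ _ => rfl)
        (fun x _ => by rw [unseen_empty, hD]; simp)
      simp only [one_mul, Finset.empty_union, ← ht, ← hq] at hcheb
      have hn1q : ((n : ℝ) - 1) = n * q := by rw [hq]; field_simp
      have hnm : (n * q) * q ^ t = m := by rw [hm]; ring
      rw [hn1q, hnm] at hcheb
      have hKsum : ∑ x : α → Fin n, (1 : ℝ) = K := by simp [hK]
      rw [hKsum] at hcheb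
      have hcs := sq_sum_le_card_mul_sum_sq (s := (Finset.univ : Finset (α → Fin n)))
        (f := fun x => |unseen D A x - m|)
      simp only [sq_abs, Finset.card_univ, ← hK] at hcs
      have hK0 : 0 ≤ K := by positivity
      have hsq : (∑ x : α → Fin n, |unseen D A x - m|) ^ 2 ≤ (K * √t) ^ 2 := by
        rw [mul_pow, Real.sq_sqrt (by positivity)]
        refine hcs.trans ?_
        have : (0 : ℝ) ≤ t := by positivity
        nlinarith [mul_le_mul_of_nonneg_left hcheb hK0, mul_nonneg this (mul_nonneg hK0 hK0)]
      have habs := abs_le_of_sq_le_sq hsq (by positivity)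
      have hdiv : ∀ x : α → Fin n, |unseen D A x / n - u| = |unseen D A x - m| / n := by
        intro x
        rw [← abs_of_pos hn', ← abs_div, abs_of_pos hn', sub_div, hm, mul_div_assoc,
          mul_div_cancel₀ _ hn'.ne']
      simp only [hdiv, ← Finset.sum_div]
      rw [← mul_div_assoc]
      exact div_le_div_of_nonneg_right ((le_abs_self _).trans habs) hn'.le
    have hrest : ‖∑ x : α → Fin n, Complex.exp (Complex.I * (θ * q * (unseen D A x - m) : ℝ)) *
          (((unseen D A x / n : ℝ) : ℂ) *
              Complex.exp (Complex.I * (-(θ * (1 - unseen D A x / n)) : ℝ)) +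
            ((1 - unseen D A x / n : ℝ) : ℂ) *
              Complex.exp (Complex.I * (θ * (unseen D A x / n) : ℝ)) - (c : ℂ))‖ ≤
        K * (|θ| ^ 3 + θ ^ 4 + θ ^ 2 * (√t / n)) := by
      refine (norm_sum_le _ _).trans ?_
      calc _ ≤ ∑ x : α → Fin n, (|θ| ^ 3 + θ ^ 4 + θ ^ 2 * |unseen D A x / n - u|) := by
            refine Finset.sum_le_sum fun x _ => ?_
            rw [norm_mul, mul_comm Complex.I (_ : ℂ), Complex.norm_exp_ofReal_mul_I, one_mul]
            exact norm_bernoulli_charFun_sub_le (div_nonneg (unseen_nonneg A x) hn'.le)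
              ((div_le_one hn').2 (unseen_le A x)) hu0 hu1 θ
        _ ≤ _ := by
            rw [Finset.sum_add_distrib, ← Finset.mul_sum, Finset.sum_const, nsmul_eq_mul,
              Finset.card_univ, ← hK]
            nlinarith [mul_le_mul_of_nonneg_left hvarbound (sq_nonneg θ)]
    have ih' := ih (θ * q)
    set Sg := ∑ x : α → Fin n, Complex.exp (Complex.I * (θ * q * (unseen D A x - m) : ℝ))
    set Rest := ∑ x : α → Fin n, Complex.exp (Complex.I * (θ * q * (unseen D A x - m) : ℝ)) *
          (((unseen D A x / n : ℝ) : ℂ) *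
              Complex.exp (Complex.I * (-(θ * (1 - unseen D A x / n)) : ℝ)) +
            ((1 - unseen D A x / n : ℝ) : ℂ) *
              Complex.exp (Complex.I * (θ * (unseen D A x / n) : ℝ)) - (c : ℂ))
    have hfin : (c : ℂ) * Sg + Rest - (Fintype.card (α → Fin n) : ℂ) *
        ((c * Real.exp (-((θ * q) ^ 2 * unseenVar n t / 2)) : ℝ) : ℂ) =
        c * (Sg - (Fintype.card (α → Fin n) : ℂ) *
          (Real.exp (-((θ * q) ^ 2 * unseenVar n t / 2)) : ℂ)) + Rest := by
      push_cast; ring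
    rw [hfin]
    refine (norm_add_le _ _).trans ?_
    rw [norm_mul, Complex.norm_real, Real.norm_eq_abs, abs_of_nonneg hc0]
    have hθq : |θ * q| ≤ |θ| := by
      rw [abs_mul, abs_of_nonneg hq0]; exact mul_le_of_le_one_right (abs_nonneg _) hq1
    have h2 : (θ * q) ^ 2 ≤ θ ^ 2 := sq_le_sq.2 hθq
    have h4 : (θ * q) ^ 4 ≤ θ ^ 4 := by nlinarith [sq_nonneg (θ * q), sq_nonneg θ]
    have h3 : |θ * q| ^ 3 ≤ |θ| ^ 3 := by gcongr
    have hsqrt : √(t : ℝ) ≤ √((t + 1 : ℕ) : ℝ) := Real.sqrt_le_sqrt (by push_cast; linarith)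
    have hdd : √(t : ℝ) / n ≤ √((t + 1 : ℕ) : ℝ) / n := by gcongr
    have hK0 : 0 ≤ K := by positivity
    set err := |θ| ^ 3 + θ ^ 4 + θ ^ 2 * (√((t + 1 : ℕ) : ℝ) / n)
    have herr1 : |θ * q| ^ 3 + (θ * q) ^ 4 + (θ * q) ^ 2 * (√(t : ℝ) / n) ≤ err := by
      refine add_le_add (add_le_add h3 h4) ?_
      gcongr
    have herr2 : |θ| ^ 3 + θ ^ 4 + θ ^ 2 * (√(t : ℝ) / n) ≤ err := by
      refine add_le_add le_rfl ?_
      gcongr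
    calc _ ≤ 1 * (K * (t * err)) + K * err := by
          refine add_le_add ?_ (hrest.trans (by gcongr))
          refine mul_le_mul hc1 (ih'.trans (by gcongr)) (norm_nonneg _) zero_le_one
      _ = _ := by push_cast; ring

end CharFun

/-- The set of vertices reachable from `v`. -/
noncomputable def reachSet {n k : ℕ} (f : Fin n × Fin k → Fin n) (v : Fin n) : Finset (Fin n) :=
  Finset.univ.filter (Reaches f v)

/-- The next vertex to be explored: a discovered unexplored one if there is any. -/
noncomputable def nextVertex {n : ℕ} (u : Fin n) (p : Finset (Fin n) × Finset (Fin n)) : Fin n :=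
  if h : (p.2 \ p.1).Nonempty then (p.2 \ p.1).min' h
  else if h : (p.1)ᶜ.Nonempty then (p.1)ᶜ.min' h else u

/-- The sets of explored and of discovered vertices after `j` steps of the exploration started
at `u`. -/
noncomputable def explore {n k : ℕ} (f : Fin n × Fin k → Fin n) (u : Fin n) :
    ℕ → Finset (Fin n) × Finset (Fin n)
  | 0 => (∅, {u})
  | j + 1 => (insert (nextVertex u (explore f u j)) (explore f u j).1,
      (explore f u j).2 ∪ Finset.univ.image fun i => f (nextVertex u (explore f u j), i))

/-- The rows of `f` listed in the order in which the exploration from `u` reveals them. -/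
noncomputable def reorder {n k : ℕ} (u : Fin n) (f : Fin n × Fin k → Fin n) :
    Fin n × Fin k → Fin n :=
  fun p => f (nextVertex u (explore f u p.1), p.2)

/-- The indices of the entries in the first `j` rows. -/
def firstRows (n k j : ℕ) : Finset (Fin n × Fin k) :=
  Finset.univ.filter fun p => (p.1 : ℕ) < j

/-- The number of distinct values among `u` and the first `j` rows of `x`. -/
noncomputable def seenCount {n k : ℕ} (u : Fin n) (x : Fin n × Fin k → Fin n) (j : ℕ) : ℕ :=
  ({u} ∪ (firstRows n k j).image x).card

/-- The first `j` such that at most `j` values are seen in the first `j` rows. -/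
noncomputable def hittingRow {n k : ℕ} (u : Fin n) (x : Fin n × Fin k → Fin n) : ℕ :=
  sInf {j | seenCount u x j ≤ j}

section Explore

variable {n k : ℕ}

lemma nextVertex_notMem {u : Fin n} {p : Finset (Fin n) × Finset (Fin n)} (hp : p.1.card < n) :
    nextVertex u p ∉ p.1 := by
  unfold nextVertex
  split_ifs with h1 h2
  · exact (Finset.mem_sdiff.1 (Finset.min'_mem _ h1)).2
  · exact Finset.mem_compl.1 (Finset.min'_mem _ h2)
  · exfalso
    apply h2
    rw [← Finset.card_pos, Finset.card_compl, Fintype.card_fin]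
    omega

lemma card_explore_fst (f : Fin n × Fin k → Fin n) (u : Fin n) {j : ℕ} (hj : j ≤ n) :
    (explore f u j).1.card = j := by
  induction j with
  | zero => simp [explore]
  | succ j ih =>
    have := ih (by omega)
    simp only [explore]
    rw [Finset.card_insert_of_notMem (nextVertex_notMem (by omega)), this]

lemma explore_fst_eq_image (f : Fin n × Fin k → Fin n) (u : Fin n) (j : ℕ) :
    (explore f u j).1 = (Finset.range j).image fun i => nextVertex u (explore f u i) := by
  induction j with
  | zero => simp [explore]
  | succ j ih => rw [Finset.range_add_one, Finset.image_insert, ← ih]; rfl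

lemma exists_nextVertex_eq (f : Fin n × Fin k → Fin n) (u v : Fin n) :
    ∃ j : Fin n, nextVertex u (explore f u j) = v := by
  have h : (explore f u n).1 = Finset.univ := by
    rw [← Finset.card_eq_iff_eq_univ, card_explore_fst f u le_rfl, Fintype.card_fin]
  have hv : v ∈ (explore f u n).1 := by rw [h]; exact Finset.mem_univ v
  rw [explore_fst_eq_image, Finset.mem_image] at hv
  obtain ⟨j, hj, rfl⟩ := hv
  exact ⟨⟨j, Finset.mem_range.1 hj⟩, rfl⟩

lemma explore_snd_eq (f : Fin n × Fin k → Fin n) (u : Fin n) {j : ℕ} (hj : j ≤ n) :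
    (explore f u j).2 = {u} ∪ (firstRows n k j).image (reorder u f) := by
  induction j with
  | zero => simp [explore, firstRows]
  | succ j ih =>
    simp only [explore]
    rw [ih (by omega)]
    ext v
    simp only [Finset.mem_union, Finset.mem_singleton, Finset.mem_image, firstRows,
      Finset.mem_filter, Finset.mem_univ, true_and, Prod.exists, reorder, or_assoc]
    refine or_congr_right ⟨?_, ?_⟩
    · rintro (⟨a, b, h, rfl⟩ | ⟨i, rfl⟩)
      · exact ⟨a, b, by omega, rfl⟩
      · exact ⟨⟨j, by omega⟩, i, by simp, rfl⟩
    · rintro ⟨a, b, h, rfl⟩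
      rcases Nat.lt_succ_iff_lt_or_eq.1 h with h | h
      · exact Or.inl ⟨a, b, h, rfl⟩
      · exact Or.inr ⟨b, by rw [h]⟩

/-- The principle of deferred decisions: listing the rows in the order of their exploration is a
bijection. -/
lemma reorder_bijective (u : Fin n) :
    Function.Bijective (reorder u : (Fin n × Fin k → Fin n) → _) := by
  refine Finite.injective_iff_bijective.1 fun f g hfg => ?_
  have hex : ∀ j ≤ n, explore f u j = explore g u j := by
    intro j
    induction j with
    | zero => intro _; rfl
    | succ j ih =>
      intro hj
      have h := ih (by omega)
      simp only [explore]
      rw [← h]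
      congr 2
      refine Finset.image_congr fun i _ => ?_
      have := congrFun hfg (⟨j, by omega⟩, i)
      simpa [reorder, ← h] using this
  ext ⟨v, i⟩ : 1
  obtain ⟨j, rfl⟩ := exists_nextVertex_eq f u v
  have := congrFun hfg (j, i)
  simpa [reorder, ← hex j j.2.le] using this

lemma firstRows_mono {i j : ℕ} (h : i ≤ j) : firstRows n k i ⊆ firstRows n k j := by
  intro p hp
  simp only [firstRows, Finset.mem_filter, Finset.mem_univ, true_and] at hp ⊢
  omega

lemma seenCount_mono (u : Fin n) (x : Fin n × Fin k → Fin n) : Monotone (seenCount u x) :=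
  fun _ _ h => Finset.card_le_card
    (Finset.union_subset_union_right (Finset.image_subset_image (firstRows_mono h)))

lemma seenCount_le (u : Fin n) (x : Fin n × Fin k → Fin n) (j : ℕ) : seenCount u x j ≤ n :=
  (Finset.card_le_univ _).trans_eq (Fintype.card_fin n)

lemma seenCount_hittingRow_le (u : Fin n) (x : Fin n × Fin k → Fin n) :
    seenCount u x (hittingRow u x) ≤ hittingRow u x :=
  Nat.sInf_mem (s := {j | seenCount u x j ≤ j}) ⟨n, seenCount_le u x n⟩

lemma hittingRow_le {u : Fin n} {x : Fin n × Fin k → Fin n} {j : ℕ} (h : seenCount u x j ≤ j) :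
    hittingRow u x ≤ j :=
  Nat.sInf_le h

lemma hittingRow_pos (u : Fin n) (x : Fin n × Fin k → Fin n) : 0 < hittingRow u x := by
  by_contra h
  have h0 : hittingRow u x = 0 := by omega
  have := seenCount_hittingRow_le u x
  rw [h0] at this
  simp [seenCount, firstRows] at this

lemma seenCount_hittingRow (u : Fin n) (x : Fin n × Fin k → Fin n) :
    seenCount u x (hittingRow u x) = hittingRow u x := by
  refine le_antisymm (seenCount_hittingRow_le u x) ?_
  have hpos := hittingRow_pos u x
  by_contra h
  have h1 := seenCount_mono u x (Nat.sub_le (hittingRow u x) 1)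
  have := hittingRow_le (u := u) (x := x) (j := hittingRow u x - 1) (by omega)
  omega

lemma card_reachSet_eq_hittingRow (f : Fin n × Fin k → Fin n) (u : Fin n) :
    (reachSet f u).card = hittingRow u (reorder u f) := by
  set H := hittingRow u (reorder u f) with hH
  have hHn : H ≤ n := hittingRow_le (seenCount_le u _ n)
  have hD : ∀ j ≤ n, (explore f u j).2.card = seenCount u (reorder u f) j := by
    intro j hj; rw [explore_snd_eq f u hj]; rfl
  have hlt : ∀ j < H, nextVertex u (explore f u j) ∈ (explore f u j).2 := by
    intro j hj
    have h1 : j < seenCount u (reorder u f) j := by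
      by_contra h
      have := hittingRow_le (u := u) (x := reorder u f) (j := j) (by omega)
      omega
    have h2 : ((explore f u j).2 \ (explore f u j).1).Nonempty := by
      rw [← Finset.card_pos]
      have := Finset.le_card_sdiff (explore f u j).1 (explore f u j).2
      rw [hD j (by omega), card_explore_fst f u (by omega)] at this
      omega
    rw [nextVertex, dif_pos h2]
    exact (Finset.mem_sdiff.1 (Finset.min'_mem _ h2)).1
  have hsub : ∀ j ≤ H, (explore f u j).1 ⊆ (explore f u j).2 := by
    intro j
    induction j with
    | zero => simp [explore]
    | succ j ih =>
      intro hj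
      simp only [explore]
      exact Finset.insert_subset (Finset.mem_union_left _ (hlt j (by omega)))
        ((ih (by omega)).trans Finset.subset_union_left)
  have hreach : ∀ j ≤ H, ∀ v ∈ (explore f u j).2, Reaches f u v := by
    intro j
    induction j with
    | zero =>
      intro _ v hv
      simp only [explore, Finset.mem_singleton] at hv
      rw [hv]; exact Relation.ReflTransGen.refl
    | succ j ih =>
      intro hj v hv
      simp only [explore, Finset.mem_union, Finset.mem_image, Finset.mem_univ, true_and] at hv
      rcases hv with hv | ⟨i, rfl⟩
      · exact ih (by omega) v hv
      · exact (ih (by omega) _ (hlt j (by omega))).tail ⟨i, rfl⟩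
  have heq : (explore f u H).1 = (explore f u H).2 := by
    refine Finset.eq_of_subset_of_card_le (hsub H le_rfl) ?_
    rw [hD H hHn, card_explore_fst f u hHn]
    exact seenCount_hittingRow_le u _
  have hrow : ∀ j, ∀ v ∈ (explore f u j).1, ∀ i, f (v, i) ∈ (explore f u j).2 := by
    intro j
    induction j with
    | zero => simp [explore]
    | succ j ih =>
      intro v hv i
      simp only [explore, Finset.mem_insert] at hv ⊢
      rcases hv with rfl | hv
      · exact Finset.mem_union_right _ (Finset.mem_image_of_mem _ (Finset.mem_univ i))
      · exact Finset.mem_union_left _ (ih v hv i)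
  have hu : u ∈ (explore f u H).2 := by rw [explore_snd_eq f u hHn]; simp
  have hset : reachSet f u = (explore f u H).1 := by
    ext v
    simp only [reachSet, Finset.mem_filter, Finset.mem_univ, true_and]
    constructor
    · intro h
      induction h with
      | refl => rw [heq]; exact hu
      | tail _ hst ih =>
        obtain ⟨i, rfl⟩ := hst
        rw [heq]
        exact hrow H _ ih i
    · intro h
      exact hreach H le_rfl v (heq ▸ h)
  rw [hset, card_explore_fst f u hHn]

lemma prob_card_reachSet (u : Fin n) (Q : ℕ → Prop) :
    prob n k (fun f => Q (reachSet f u).card) = prob n k (fun x => Q (hittingRow u x)) := by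
  unfold prob
  congr 2
  refine Finset.card_bij (fun f _ => reorder u f) ?_ (fun _ _ _ _ h => (reorder_bijective u).1 h) ?_
  · intro f hf
    simpa [card_reachSet_eq_hittingRow] using hf
  · intro x hx
    obtain ⟨f, rfl⟩ := (reorder_bijective u).2 x
    exact ⟨f, by simpa [card_reachSet_eq_hittingRow] using hx, rfl⟩

end Explore

section Prob

variable {n k : ℕ} {P Q : (Fin n × Fin k → Fin n) → Prop}

lemma prob_nonneg : 0 ≤ prob n k P := by unfold prob; positivity

lemma prob_mono (h : ∀ f, P f → Q f) : prob n k P ≤ prob n k Q := by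
  unfold prob
  gcongr with f
  exact h f

lemma prob_or_le : prob n k (fun f => P f ∨ Q f) ≤ prob n k P + prob n k Q := by
  unfold prob
  rw [← add_div]
  gcongr
  refine le_trans (Nat.cast_le.2 (Finset.card_le_card ?_)) (by
    exact_mod_cast Finset.card_union_le (Finset.univ.filter P) (Finset.univ.filter Q))
  intro f
  simp

lemma prob_exists_le {ι : Type*} (s : Finset ι) (R : ι → (Fin n × Fin k → Fin n) → Prop) :
    prob n k (fun f => ∃ i ∈ s, R i f) ≤ ∑ i ∈ s, prob n k (R i) := by
  unfold prob
  rw [← Finset.sum_div]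
  gcongr
  refine le_trans (Nat.cast_le.2 (Finset.card_le_card (t := s.biUnion fun i =>
    Finset.univ.filter (R i)) ?_)) (by exact_mod_cast Finset.card_biUnion_le)
  intro f
  simp

lemma card_fun_pos (hn : 0 < n) : (0 : ℝ) < Fintype.card (Fin n × Fin k → Fin n) := by
  have : Nonempty (Fin n) := ⟨⟨0, hn⟩⟩
  exact_mod_cast Fintype.card_pos

lemma prob_add_prob_not (hn : 0 < n) : prob n k P + prob n k (fun f => ¬ P f) = 1 := by
  unfold prob
  rw [← add_div, div_eq_one_iff_eq (card_fun_pos hn).ne']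
  rw [← Nat.cast_add]
  congr 1
  rw [← Finset.card_univ, ← Finset.card_filter_add_card_filter_not (s := Finset.univ) P]
  congr!

lemma prob_le_one (hn : 0 < n) : prob n k P ≤ 1 := by
  have := prob_add_prob_not (P := P) hn
  have := prob_nonneg (P := fun f => ¬ P f)
  linarith

/-- Markov's inequality. -/
lemma prob_le_of_sum_le (hn : 0 < n) (F : (Fin n × Fin k → Fin n) → ℝ) (hF : ∀ f, 0 ≤ F f)
    {a b : ℝ} (ha : 0 < a) (hP : ∀ f, P f → a ≤ F f)
    (hb : ∑ f, F f ≤ b * Fintype.card (Fin n × Fin k → Fin n)) : prob n k P ≤ b / a := by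
  unfold prob
  rw [div_le_div_iff₀ (card_fun_pos hn) ha]
  refine le_trans ?_ hb
  rw [← nsmul_eq_mul]
  calc _ ≤ ∑ f ∈ Finset.univ.filter P, F f :=
        Finset.card_nsmul_le_sum _ _ _ fun f hf => hP f (Finset.mem_filter.1 hf).2
    _ ≤ _ := Finset.sum_le_sum_of_subset_of_nonneg (Finset.filter_subset _ _) fun f _ _ => hF f

lemma sum_ite_eq_prob [DecidablePred P] (hn : 0 < n) :
    ∑ f, (if P f then (1 : ℝ) else 0) = prob n k P * Fintype.card (Fin n × Fin k → Fin n) := by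
  unfold prob
  rw [div_mul_cancel₀ _ (card_fun_pos hn).ne', Finset.sum_boole]
  congr!

end Prob

section Restart

variable {n k : ℕ}

lemma unseen_firstRows (u : Fin n) (x : Fin n × Fin k → Fin n) (j : ℕ) :
    unseen {u} (firstRows n k j) x = n - seenCount u x j := rfl

lemma card_firstRows {j : ℕ} (hj : j ≤ n) : (firstRows n k j).card = k * j := by
  have : firstRows n k j = (Finset.univ.filter fun i : Fin n => (i : ℕ) < j) ×ˢ Finset.univ := by
    ext p; simp [firstRows]
  rw [this, Finset.card_product, Fin.card_filter_val_lt, Finset.card_univ, Fintype.card_fin,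
    min_eq_right hj, mul_comm]

lemma seenCount_update {j i : ℕ} (hij : i ≤ j) (u : Fin n) (x : Fin n × Fin k → Fin n)
    {p : Fin n × Fin k} (hp : p ∉ firstRows n k j) (y : Fin n) :
    seenCount u (Function.update x p y) i = seenCount u x i := by
  have := unseen_update (D := {u}) (fun h => hp (firstRows_mono hij h)) x y
  rw [unseen_firstRows, unseen_firstRows] at this
  exact_mod_cast (sub_right_injective this)

lemma hittingRow_eq_iff (u : Fin n) (x : Fin n × Fin k → Fin n) (j : ℕ) :
    hittingRow u x = j ↔ seenCount u x j ≤ j ∧ ∀ i < j, i < seenCount u x i := by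
  constructor
  · rintro rfl
    refine ⟨seenCount_hittingRow_le u x, fun i hi => ?_⟩
    by_contra h
    have := hittingRow_le (u := u) (x := x) (j := i) (by omega)
    omega
  · rintro ⟨h1, h2⟩
    refine le_antisymm (hittingRow_le h1) ?_
    by_contra h
    have := h2 _ (by omega : hittingRow u x < j)
    have := seenCount_hittingRow_le u x
    omega

lemma hittingRow_update_eq_iff {j : ℕ} (u : Fin n) (x : Fin n × Fin k → Fin n)
    {p : Fin n × Fin k} (hp : p ∉ firstRows n k j) (y : Fin n) :
    hittingRow u (Function.update x p y) = j ↔ hittingRow u x = j := by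
  rw [hittingRow_eq_iff, hittingRow_eq_iff, seenCount_update le_rfl u x hp]
  refine and_congr_right fun _ => forall₂_congr fun i hi => ?_
  rw [seenCount_update hi.le u x hp]

/-- After the exploration from `u` has stopped, the number of unseen values seldom drops far
below its mean. -/
lemma prob_hittingRow_mem_unseen_lt_le (hn : 0 < n) (u : Fin n) {s : ℕ} (hs : s ≤ n)
    (J : Finset ℕ) {η d : ℝ} (hη : 0 < η) (hd : 0 < d)
    (hJ : ∀ j ∈ J, j ≤ s ∧
      (n - s : ℝ) + η * (s - j) ≤ (n - j) * (1 - 1 / n : ℝ) ^ (k * (s - j))) :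
    prob n k (fun x => hittingRow u x ∈ J ∧ unseen {u} (firstRows n k s) x < n - s - d) ≤
      k / (16 * η * d) := by
  set C := (Fintype.card (Fin n × Fin k → Fin n) : ℝ) with hC
  have hC0 : 0 < C := card_fun_pos hn
  have hj : ∀ j ∈ J, prob n k (fun x => hittingRow u x = j ∧
      unseen {u} (firstRows n k s) x < n - s - d) ≤
      k / (16 * η * d) * prob n k (fun x => hittingRow u x = j) := by
    intro j hjJ
    obtain ⟨hjs, hjq⟩ := hJ j hjJ
    have hsub := firstRows_mono (n := n) (k := k) hjs
    have hcheb := sum_unseen_sub_sq_le (D := {u}) hn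
      (Finset.disjoint_sdiff : Disjoint (firstRows n k j) (firstRows n k s \ firstRows n k j))
      (n - j) (fun x => if hittingRow u x = j then 1 else 0) (fun x => by split_ifs <;> norm_num)
      (fun a ha x y => by rw [if_congr (hittingRow_update_eq_iff u x ha y) rfl rfl])
      (fun x hx => by
        have hx' : hittingRow u x = j := by by_contra h; simp [h] at hx
        have := seenCount_hittingRow u x
        rw [hx'] at this
        rw [unseen_firstRows, this])
    rw [Finset.union_sdiff_of_subset hsub, Finset.card_sdiff_of_subset hsub, card_firstRows hs,
      card_firstRows (hjs.trans hs), ← Nat.mul_sub, sum_ite_eq_prob hn] at hcheb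
    have hsj : (0 : ℝ) ≤ (s : ℝ) - j := by
      have : (j : ℝ) ≤ s := by exact_mod_cast hjs
      linarith
    have hpos : 0 < (η * (s - j) + d) ^ 2 := by positivity
    have hm := prob_le_of_sum_le (P := fun x => hittingRow u x = j ∧
      unseen {u} (firstRows n k s) x < n - s - d) hn
      (F := fun x => (if hittingRow u x = j then (1 : ℝ) else 0) *
        (unseen {u} (firstRows n k s) x - (n - j) * (1 - 1 / n) ^ (k * (s - j))) ^ 2)
      (fun x => mul_nonneg (by split_ifs <;> norm_num) (sq_nonneg _)) hpos
      (fun x hx => by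
        rw [if_pos hx.1, one_mul, sq_le_sq, abs_of_nonneg (by positivity),
          abs_of_nonpos (by nlinarith [hx.2])]
        linarith [hx.2])
      (b := ((k * (s - j) : ℕ) : ℝ) / 4 * prob n k (fun x => hittingRow u x = j))
      (by rw [mul_assoc]; exact hcheb)
    refine hm.trans ?_
    rw [mul_div_right_comm]
    refine mul_le_mul_of_nonneg_right ?_ prob_nonneg
    rw [div_le_div_iff₀ hpos (by positivity)]
    push_cast [Nat.cast_sub hjs]
    have : 0 ≤ (k : ℝ) * (η * (s - j) - d) ^ 2 := by positivity
    nlinarith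
  have hor : prob n k (fun x => hittingRow u x ∈ J ∧ unseen {u} (firstRows n k s) x < n - s - d) ≤
      ∑ j ∈ J, prob n k (fun x => hittingRow u x = j ∧
        unseen {u} (firstRows n k s) x < n - s - d) :=
    (prob_mono fun x hx => ⟨hittingRow u x, hx.1, rfl, hx.2⟩).trans (prob_exists_le J _)
  refine hor.trans ((Finset.sum_le_sum hj).trans ?_)
  rw [← Finset.mul_sum]
  refine mul_le_of_le_one_right (by positivity) ?_
  have hsum : ∑ j ∈ J, prob n k (fun x => hittingRow u x = j) =
      prob n k (fun x => hittingRow u x ∈ J) := by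
    unfold prob
    rw [← Finset.sum_div]
    congr 1
    rw [← Nat.cast_sum, ← Finset.card_biUnion]
    · congr 2; ext x; simp
    · intro i _ j _ hij
      refine Finset.disjoint_left.2 fun x hx hx' => hij ?_
      have h1 : hittingRow u x = i := by simpa using hx
      have h2 : hittingRow u x = j := by simpa using hx'
      rw [← h1, h2]
  rw [hsum]
  exact prob_le_one hn

end Restart

section ClosedSets

variable {n k : ℕ}

lemma prob_isClosedSet (hn : 0 < n) (S : Finset (Fin n)) :
    prob n k (fun f => IsClosedSet f S) = ((S.card : ℝ) / n) ^ (k * S.card) := by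
  have hn' : (n : ℝ) ≠ 0 := by positivity
  have hset : (Finset.univ.filter fun f : Fin n × Fin k → Fin n => IsClosedSet f S) =
      Fintype.piFinset fun p => if p.1 ∈ S then S else Finset.univ := by
    ext f
    simp only [IsClosedSet, Finset.mem_filter, Finset.mem_univ, true_and, Fintype.mem_piFinset,
      Finset.mem_coe, Prod.forall]
    refine forall_congr' fun v => ?_
    by_cases hv : v ∈ S <;> simp [hv]
  unfold prob
  rw [hset, Fintype.card_piFinset, Fintype.card_fun, Fintype.card_fin, Nat.cast_prod,
    Nat.cast_pow, ← Finset.card_univ, ← Finset.prod_const, ← Finset.prod_div_distrib,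
    Fintype.prod_prod_type]
  have : ∀ v : Fin n, ∏ _i : Fin k, (((if v ∈ S then S else Finset.univ).card : ℝ) / n) =
      if v ∈ S then ((S.card : ℝ) / n) ^ k else 1 := by
    intro v
    by_cases hv : v ∈ S
    · simp [hv, div_pow]
    · simp [hv, hn']
  simp only [this]
  rw [Finset.prod_ite_mem, Finset.univ_inter, Finset.prod_const, pow_mul]

lemma sum_range_mul_half_pow_le (m : ℕ) :
    ∑ j ∈ Finset.range m, (j : ℝ) * (1 / 2) ^ j ≤ 2 - (m + 1) * 2 * (1 / 2) ^ m := by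
  induction m with
  | zero => norm_num
  | succ m ih =>
    rw [Finset.sum_range_succ, pow_succ]
    push_cast
    linarith

/-- With high probability there are no small nonempty closed sets. -/
lemma prob_exists_small_isClosedSet_le (hn : 0 < n) (hk : 2 ≤ k) :
    prob n k (fun f => ∃ S : Finset (Fin n), S.Nonempty ∧ 6 * S.card ≤ n ∧ IsClosedSet f S) ≤
      12 / n := by
  have hn' : (0 : ℝ) < n := by positivity
  have hterm : ∀ j ∈ Finset.range (n + 1), ∑ S ∈ (Finset.univ : Finset (Fin n)).powersetCard j,
      (if S.Nonempty ∧ 6 * S.card ≤ n then prob n k (fun f => IsClosedSet f S) else 0) ≤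
      6 / n * (j * (1 / 2) ^ j) := by
    intro j _
    have hS : ∀ S ∈ (Finset.univ : Finset (Fin n)).powersetCard j,
        (if S.Nonempty ∧ 6 * S.card ≤ n then prob n k (fun f => IsClosedSet f S) else 0) =
        if 0 < j ∧ 6 * j ≤ n then ((j : ℝ) / n) ^ (k * j) else 0 := by
      intro S hS
      obtain ⟨_, rfl⟩ := Finset.mem_powersetCard.1 hS
      rw [prob_isClosedSet hn]
      simp only [Finset.card_pos]
    rw [Finset.sum_congr rfl hS, Finset.sum_const, Finset.card_powersetCard, Finset.card_univ,
      Fintype.card_fin, nsmul_eq_mul]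
    split_ifs with h
    · have hj0 : (0 : ℝ) < j := by exact_mod_cast h.1
      have hjn : 6 * (j : ℝ) ≤ n := by exact_mod_cast h.2
      have h1 : ((j : ℝ) / n) ^ (k * j) ≤ ((j : ℝ) / n) ^ (2 * j) :=
        pow_le_pow_of_le_one (by positivity) (by rw [div_le_one hn']; linarith)
          (Nat.mul_le_mul_right j hk)
      have h2 : (n.choose j : ℝ) ≤ n ^ j / j.factorial := Nat.choose_le_pow_div j n
      have h3 : (j : ℝ) ^ j / j.factorial ≤ 3 ^ j := by
        refine (Real.pow_div_factorial_le_exp (j : ℝ) hj0.le j).trans ?_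
        rw [← mul_one (j : ℝ), Real.exp_nat_mul]
        exact pow_le_pow_left₀ (Real.exp_pos 1).le
          (Real.exp_one_lt_d9.le.trans (by norm_num)) j
      calc (n.choose j : ℝ) * ((j : ℝ) / n) ^ (k * j)
          ≤ (n ^ j / j.factorial) * ((j : ℝ) / n) ^ (2 * j) := by gcongr
        _ = (j : ℝ) ^ j / j.factorial * ((j : ℝ) / n) ^ j := by
            rw [two_mul, pow_add, div_pow]; field_simp
        _ ≤ 3 ^ j * ((j : ℝ) / n) ^ j := by gcongr
        _ = (3 * j / n) ^ j := by rw [← mul_pow, mul_div_assoc]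
        _ = (3 * j / n) ^ (j - 1) * (3 * j / n) := by
            rw [← pow_succ, Nat.sub_add_cancel h.1]
        _ ≤ (1 / 2) ^ (j - 1) * (3 * j / n) := by
            exact mul_le_mul_of_nonneg_right (pow_le_pow_left₀ (by positivity)
              (by rw [div_le_iff₀ hn']; linarith) _) (by positivity)
        _ = 6 / n * (j * (1 / 2) ^ j) := by
            obtain ⟨i, rfl⟩ : ∃ i, j = i + 1 := ⟨j - 1, by omega⟩
            rw [Nat.add_sub_cancel, pow_succ]; ring
    · rw [mul_zero]; positivity
  calc _ ≤ prob n k (fun f => ∃ S ∈ (Finset.univ : Finset (Finset (Fin n))),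
          S.Nonempty ∧ 6 * S.card ≤ n ∧ IsClosedSet f S) := prob_mono (by simp)
    _ ≤ ∑ S : Finset (Fin n), prob n k (fun f => S.Nonempty ∧ 6 * S.card ≤ n ∧ IsClosedSet f S) :=
        prob_exists_le _ _
    _ = ∑ S : Finset (Fin n),
          (if S.Nonempty ∧ 6 * S.card ≤ n then prob n k (fun f => IsClosedSet f S) else 0) := by
        refine Finset.sum_congr rfl fun S _ => ?_
        split_ifs with h
        · simp [h.1, h.2]
        · simp only [← and_assoc, h, false_and]
          simp [prob]
    _ = ∑ j ∈ Finset.range (n + 1), ∑ S ∈ (Finset.univ : Finset (Fin n)).powersetCard j,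
          (if S.Nonempty ∧ 6 * S.card ≤ n then prob n k (fun f => IsClosedSet f S) else 0) := by
        rw [← Finset.powerset_univ, Finset.sum_powerset, Finset.card_univ, Fintype.card_fin]
    _ ≤ ∑ j ∈ Finset.range (n + 1), 6 / n * (j * (1 / 2) ^ j : ℝ) := Finset.sum_le_sum hterm
    _ ≤ 12 / n := by
        rw [← Finset.mul_sum]
        have h := sum_range_mul_half_pow_le (n + 1)
        have h' : (0 : ℝ) ≤ (((n + 1 : ℕ) : ℝ) + 1) * 2 * (1 / 2) ^ (n + 1) := by positivity
        calc 6 / n * _ ≤ 6 / n * (2 : ℝ) := by gcongr; linarith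
          _ = 12 / n := by ring

end ClosedSets

section Reach

variable {n k : ℕ} {f : Fin n × Fin k → Fin n}

lemma mem_reachSet {u v : Fin n} : v ∈ reachSet f u ↔ Reaches f u v := by
  simp [reachSet]

lemma self_mem_reachSet (u : Fin n) : u ∈ reachSet f u := mem_reachSet.2 .refl

lemma isClosedSet_reachSet (u : Fin n) : IsClosedSet f (reachSet f u : Set (Fin n)) := by
  intro v hv i
  rw [Finset.mem_coe, mem_reachSet] at hv ⊢
  exact hv.tail ⟨i, rfl⟩

lemma reachSet_subset {u v : Fin n} (h : v ∈ reachSet f u) : reachSet f v ⊆ reachSet f u :=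
  fun _ hw => mem_reachSet.2 ((mem_reachSet.1 h).trans (mem_reachSet.1 hw))

lemma Reaches.update_or {v z x : Fin n} (i : Fin k) (y : Fin n) (h : Reaches f v z) :
    Reaches (Function.update f (x, i) y) v x ∨ Reaches (Function.update f (x, i) y) v z := by
  induction h with
  | refl => exact Or.inr .refl
  | @tail b c _ hst ih =>
    rcases ih with ih | ih
    · exact Or.inl ih
    · by_cases hb : b = x
      · subst hb; exact Or.inl ih
      · obtain ⟨l, rfl⟩ := hst
        refine Or.inr (ih.tail ⟨l, ?_⟩)
        rw [Function.update_of_ne (by simp [hb])]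

/-- Whether `v` reaches `x` does not depend on the arcs leaving `x`. -/
lemma mem_reachSet_update {v x : Fin n} (i : Fin k) (y : Fin n) :
    x ∈ reachSet (Function.update f (x, i) y) v ↔ x ∈ reachSet f v := by
  simp only [mem_reachSet]
  constructor
  · intro h
    simpa using h.update_or (x := x) i (f (x, i))
  · intro h
    simpa using h.update_or (x := x) i y

/-- The set of vertices reachable from `u` does not depend on the arcs leaving vertices outside
of it. -/
lemma reachSet_update_eq_iff {u x : Fin n} {S : Finset (Fin n)} (hx : x ∉ S) (i : Fin k)
    (y : Fin n) : reachSet (Function.update f (x, i) y) u = S ↔ reachSet f u = S := by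
  have key : ∀ (g : Fin n × Fin k → Fin n) (z : Fin n), x ∉ reachSet g u →
      reachSet g u ⊆ reachSet (Function.update g (x, i) z) u := by
    intro g z hg w hw
    rcases (mem_reachSet.1 hw).update_or (x := x) i z with h | h
    · exact absurd ((mem_reachSet_update i z).1 (mem_reachSet.2 h)) hg
    · exact mem_reachSet.2 h
  have heq : x ∉ reachSet f u → reachSet (Function.update f (x, i) y) u = reachSet f u := by
    intro hf
    refine Finset.Subset.antisymm ?_ (key f y hf)
    have := key (Function.update f (x, i) y) (f (x, i)) (by rwa [mem_reachSet_update])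
    simpa using this
  constructor
  · intro h
    rw [← heq (by rwa [← mem_reachSet_update i y, h])]
    exact h
  · rintro rfl
    exact heq hx

lemma prob_and_apply_eq (hn : 0 < n) {P : (Fin n × Fin k → Fin n) → Prop} (a : Fin n × Fin k)
    (hP : ∀ f y, P (Function.update f a y) ↔ P f) (w : Fin n) :
    prob n k (fun f => P f ∧ f a = w) = prob n k P / n := by
  have hn' : (n : ℝ) ≠ 0 := by positivity
  have h := sum_update_eq a (fun f : Fin n × Fin k → Fin n => if P f ∧ f a = w then (1 : ℝ) else 0)
  rw [sum_ite_eq_prob hn, nsmul_eq_mul, Fintype.card_fin] at h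
  have h' : ∀ f : Fin n × Fin k → Fin n, ∑ y, (if P (Function.update f a y) ∧
      Function.update f a y a = w then (1 : ℝ) else 0) = if P f then 1 else 0 := by
    intro f
    by_cases hf : P f <;> simp [hP, hf]
  simp only [h'] at h
  rw [sum_ite_eq_prob hn] at h
  rw [eq_div_iff hn']
  refine mul_right_cancel₀ (card_fun_pos (k := k) hn).ne' ?_
  rw [h]; ring

lemma prob_reachSet_eq_and_mem_le (hn : 0 < n) (u v w : Fin n) {S : Finset (Fin n)}
    (hw : w ∉ S) :
    prob n k (fun f => reachSet f u = S ∧ w ∈ reachSet f v) ≤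
      prob n k (fun f => reachSet f u = S ∧ w = v) +
        k / n * ∑ x ∈ Sᶜ, prob n k (fun f => reachSet f u = S ∧ x ∈ reachSet f v) := by
  have hpt : ∀ f : Fin n × Fin k → Fin n, (reachSet f u = S ∧ w ∈ reachSet f v) →
      (reachSet f u = S ∧ w = v) ∨ ∃ p ∈ Sᶜ ×ˢ (Finset.univ : Finset (Fin k)),
        ((reachSet f u = S ∧ p.1 ∈ reachSet f v) ∧ f p = w) := by
    rintro f ⟨rfl, h⟩
    rcases (mem_reachSet.1 h).cases_tail with h | ⟨x, hx, i, hi⟩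
    · exact Or.inl ⟨rfl, h⟩
    · refine Or.inr ⟨(x, i), ?_, ⟨rfl, mem_reachSet.2 hx⟩, hi⟩
      simp only [Finset.mem_product, Finset.mem_compl, Finset.mem_univ, and_true]
      intro hxS
      exact hw (hi ▸ isClosedSet_reachSet u x (by exact_mod_cast hxS) i)
  refine (prob_mono hpt).trans (prob_or_le.trans (add_le_add le_rfl ?_))
  refine (prob_exists_le _ _).trans (le_of_eq ?_)
  rw [Finset.sum_product, Finset.mul_sum]
  refine Finset.sum_congr rfl fun x hx => ?_
  have hx' : x ∉ S := Finset.mem_compl.1 hx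
  have : ∀ i : Fin k, prob n k (fun f => (reachSet f u = S ∧ x ∈ reachSet f v) ∧ f (x, i) = w) =
      prob n k (fun f => reachSet f u = S ∧ x ∈ reachSet f v) / n := fun i =>
    prob_and_apply_eq hn (x, i)
      (fun f y => and_congr (reachSet_update_eq_iff hx' i y) (mem_reachSet_update i y)) w
  simp only [this, Finset.sum_const, Finset.card_univ, Fintype.card_fin, nsmul_eq_mul]
  ring

lemma sum_prob_reachSet_eq_and_mem_le (hn : 0 < n) (u v : Fin n) {b ρ : ℝ} (hρ : ρ < 1)
    (hb : k * (n - b) ≤ ρ * n) {S : Finset (Fin n)} (hbS : b ≤ S.card) :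
    ∑ w ∈ Sᶜ, prob n k (fun f => reachSet f u = S ∧ w ∈ reachSet f v) ≤
      1 / (1 - ρ) * prob n k (fun f => reachSet f u = S) := by
  have hn' : (0 : ℝ) < n := by positivity
  have hM0 : 0 ≤ ∑ w ∈ Sᶜ, prob n k (fun f => reachSet f u = S ∧ w ∈ reachSet f v) :=
    Finset.sum_nonneg fun _ _ => prob_nonneg
  have h1 := Finset.sum_le_sum fun w (hw : w ∈ Sᶜ) =>
    prob_reachSet_eq_and_mem_le (k := k) hn u v w (Finset.mem_compl.1 hw)
  have h2 : ∑ w ∈ Sᶜ, prob n k (fun f => reachSet f u = S ∧ w = v) ≤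
      prob n k (fun f => reachSet f u = S) := by
    calc _ ≤ ∑ w : Fin n, prob n k (fun f => reachSet f u = S ∧ w = v) :=
          Finset.sum_le_sum_of_subset_of_nonneg (Finset.subset_univ _) fun _ _ _ => prob_nonneg
      _ = ∑ w : Fin n, if w = v then prob n k (fun f => reachSet f u = S) else 0 := by
          refine Finset.sum_congr rfl fun w _ => ?_
          by_cases h : w = v
          · simp only [h, and_true, if_true]
          · simp [h, prob]
      _ = _ := by simp
  generalize ∑ w ∈ Sᶜ, prob n k (fun f => reachSet f u = S ∧ w ∈ reachSet f v) = M at *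
  generalize prob n k (fun f => reachSet f u = S) = p at *
  rw [Finset.sum_add_distrib, Finset.sum_const, Finset.card_compl, Fintype.card_fin,
    nsmul_eq_mul, Nat.cast_sub (by simpa using Finset.card_le_univ S)] at h1
  have h3 : ((n : ℝ) - S.card) * (k / n * M) ≤ ρ * M := by
    have : (k : ℝ) * (n - S.card) ≤ ρ * n := le_trans (by gcongr) hb
    have h4 : (k : ℝ) * (n - S.card) / n ≤ ρ := by rwa [div_le_iff₀ hn']
    calc _ = (k : ℝ) * (n - S.card) / n * M := by ring
      _ ≤ _ := by gcongr
  rw [one_div, inv_mul_eq_div, le_div_iff₀ (by linarith)]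
  linarith

/-- Outside of a large set of vertices reachable from `u`, exploring from `v` is subcritical. -/
lemma sum_card_reachSet_sdiff_le (hn : 0 < n) (u v : Fin n) {b ρ : ℝ} (hρ : ρ < 1)
    (hb : k * (n - b) ≤ ρ * n) :
    ∑ f : Fin n × Fin k → Fin n,
        (if b ≤ (reachSet f u).card then ((reachSet f v \ reachSet f u).card : ℝ) else 0) ≤
      1 / (1 - ρ) * Fintype.card (Fin n × Fin k → Fin n) := by
  have hn' : (0 : ℝ) < n := by positivity
  set C := (Fintype.card (Fin n × Fin k → Fin n) : ℝ) with hC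
  have hC0 : 0 < C := card_fun_pos hn
  have hfib : ∀ f : Fin n × Fin k → Fin n,
      (if b ≤ (reachSet f u).card then ((reachSet f v \ reachSet f u).card : ℝ) else 0) =
      ∑ S ∈ Finset.univ.filter (fun S : Finset (Fin n) => b ≤ S.card), ∑ w ∈ Sᶜ,
        if reachSet f u = S ∧ w ∈ reachSet f v then (1 : ℝ) else 0 := by
    intro f
    have hin : ∀ S : Finset (Fin n), ∑ w ∈ Sᶜ,
        (if reachSet f u = S ∧ w ∈ reachSet f v then (1 : ℝ) else 0) =
        if reachSet f u = S then ((reachSet f v \ S).card : ℝ) else 0 := by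
      intro S
      by_cases h : reachSet f u = S
      · simp only [h, true_and, if_true]
        rw [Finset.sum_boole]
        congr 2
        ext; simp [and_comm]
      · simp [h]
    simp only [hin]
    rw [Finset.sum_ite_eq]
    simp
  simp only [hfib]
  rw [Finset.sum_comm]
  have hsw : ∀ S ∈ Finset.univ.filter (fun S : Finset (Fin n) => b ≤ S.card),
      ∑ f : Fin n × Fin k → Fin n, ∑ w ∈ Sᶜ,
        (if reachSet f u = S ∧ w ∈ reachSet f v then (1 : ℝ) else 0) ≤
      1 / (1 - ρ) * prob n k (fun f => reachSet f u = S) * C := by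
    intro S hSb
    rw [Finset.sum_comm]
    simp only [sum_ite_eq_prob hn, ← Finset.sum_mul]
    gcongr
    exact sum_prob_reachSet_eq_and_mem_le hn u v hρ hb (by simpa using hSb)
  refine (Finset.sum_le_sum hsw).trans ?_
  rw [← Finset.sum_mul, ← Finset.mul_sum]
  have h1ρ : 0 < 1 - ρ := by linarith
  have hle : ∑ S ∈ Finset.univ.filter (fun S : Finset (Fin n) => b ≤ S.card),
      prob n k (fun f => reachSet f u = S) ≤ 1 := by
    refine (Finset.sum_le_sum_of_subset_of_nonneg (Finset.filter_subset _ _)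
      fun _ _ _ => prob_nonneg).trans (le_of_eq ?_)
    refine mul_right_cancel₀ hC0.ne' ?_
    rw [Finset.sum_mul]
    simp only [hC, ← sum_ite_eq_prob hn]
    rw [Finset.sum_comm]
    simp
  calc _ ≤ 1 / (1 - ρ) * 1 * C := by gcongr
    _ = _ := by ring

end Reach

section Giant

variable {n k : ℕ} {f : Fin n × Fin k → Fin n}

lemma eq_reachSet_of_isClosedSet_of_isStrConn {G : Set (Fin n)} (h1 : IsClosedSet f G)
    (h2 : IsStrConn f G) {u : Fin n} (hu : u ∈ G) : G = reachSet f u := by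
  ext v
  rw [Finset.mem_coe, mem_reachSet]
  constructor
  · exact h2.2 u hu v
  · intro h
    induction h with
    | refl => exact hu
    | tail _ hst ih => obtain ⟨i, rfl⟩ := hst; exact h1 _ ih i

lemma exists_isClosedSet_isStrConn (hn : 0 < n) (f : Fin n × Fin k → Fin n) :
    ∃ G : Set (Fin n), IsClosedSet f G ∧ IsStrConn f G := by
  obtain ⟨u, -, hu⟩ := Finset.exists_min_image Finset.univ (fun u => (reachSet f u).card)
    ⟨⟨0, hn⟩, Finset.mem_univ _⟩
  refine ⟨reachSet f u, isClosedSet_reachSet u, ⟨u, by simp [self_mem_reachSet]⟩, ?_⟩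
  intro v hv w hw
  have hsub := reachSet_subset (f := f) (by exact_mod_cast hv : v ∈ reachSet f u)
  have heq := Finset.eq_of_subset_of_card_le hsub (hu v (Finset.mem_univ v))
  rw [← mem_reachSet, heq]
  exact_mod_cast hw

lemma exists_isGiant (hn : 0 < n) (f : Fin n × Fin k → Fin n) : ∃ G, IsGiant f G := by
  set F : Finset (Set (Fin n)) := Finset.univ.filter fun G => IsClosedSet f G ∧ IsStrConn f G
    with hF
  have hF0 : F.Nonempty := by
    obtain ⟨G, hG⟩ := exists_isClosedSet_isStrConn hn f
    exact ⟨G, by simpa [hF] using hG⟩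
  obtain ⟨G₀, hG₀, hmax⟩ := F.exists_max_image (fun G => G.ncard) hF0
  have hmem : ∀ S, S ∈ F ↔ IsClosedSet f S ∧ IsStrConn f S := by simp [hF]
  set V : Finset (Fin n) := Finset.univ.filter fun v => ∃ S ∈ F, S.ncard = G₀.ncard ∧ v ∈ S with hV
  have hV0 : V.Nonempty := by
    obtain ⟨v, hv⟩ := ((hmem G₀).1 hG₀).2.1
    refine ⟨v, ?_⟩
    simp only [hV, Finset.mem_filter, Finset.mem_univ, true_and]
    exact ⟨G₀, hG₀, rfl, hv⟩
  obtain ⟨G, hG, hcard, hv⟩ := (Finset.mem_filter.1 (V.min'_mem hV0)).2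
  refine ⟨G, ((hmem G).1 hG).1, ((hmem G).1 hG).2, fun S h1 h2 => ?_, fun S h1 h2 h3 => ?_⟩
  · rw [hcard]; exact hmax S ((hmem S).2 ⟨h1, h2⟩)
  · refine ⟨V.min' hV0, hv, fun u hu => V.min'_le u ?_⟩
    simp only [hV, Finset.mem_filter, Finset.mem_univ, true_and]
    exact ⟨S, (hmem S).2 ⟨h1, h2⟩, h3.trans hcard, hu⟩

lemma IsGiant.exists_eq_reachSet {G : Set (Fin n)} (h : IsGiant f G) :
    ∃ S : Finset (Fin n), G = S ∧ S.Nonempty ∧ ∀ u ∈ S, reachSet f u = S := by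
  obtain ⟨u, hu⟩ := h.2.1.1
  have key := fun v (hv : v ∈ G) => eq_reachSet_of_isClosedSet_of_isStrConn h.1 h.2.1 hv
  refine ⟨reachSet f u, key u hu, ⟨u, self_mem_reachSet u⟩, fun v hv => ?_⟩
  have hv' : v ∈ G := by rw [key u hu]; exact_mod_cast hv
  exact_mod_cast (key v hv').symm.trans (key u hu)

end Giant

section NormalLimit

open ProbabilityTheory Topology

/-- The cumulative distribution function of the standard normal law. -/
noncomputable def stdNormalCDF (x : ℝ) : ℝ :=
  (Real.sqrt (2 * Real.pi))⁻¹ * ∫ t in Set.Iic x, Real.exp (-t ^ 2 / 2)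

lemma stdNormalCDF_eq_gaussianReal (x : ℝ) :
    stdNormalCDF x = (gaussianReal 0 1).real (Set.Iic x) := by
  rw [measureReal_def, gaussianReal_apply_eq_integral _ one_ne_zero, ENNReal.toReal_ofReal
    (integral_nonneg fun _ => gaussianPDFReal_nonneg _ _ _), gaussianPDFReal_def, stdNormalCDF,
    ← integral_const_mul]
  simp

lemma continuous_stdNormalCDF : Continuous stdNormalCDF := by
  have hexp : Integrable (fun t : ℝ => Real.exp (-t ^ 2 / 2)) := by
    refine (integrable_exp_neg_mul_sq (b := 1 / 2) (by norm_num)).congr (ae_of_all _ fun t => ?_)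
    simp only
    congr 1; ring
  have h : ∀ x, stdNormalCDF x = (Real.sqrt (2 * Real.pi))⁻¹ *
      ((∫ t in (0 : ℝ)..x, Real.exp (-t ^ 2 / 2)) +
        ∫ t in Set.Iic (0 : ℝ), Real.exp (-t ^ 2 / 2)) := by
    intro x
    rw [← intervalIntegral.integral_Iic_sub_Iic hexp.integrableOn hexp.integrableOn,
      sub_add_cancel, stdNormalCDF]
  rw [funext h]
  exact continuous_const.mul ((intervalIntegral.continuous_primitive
    (fun a b => hexp.intervalIntegrable) 0).add continuous_const)

/-- The law of a real function on a finite type with the uniform distribution. -/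
noncomputable def uniformLaw {Ω : Type*} [Fintype Ω] (X : Ω → ℝ) : Measure ℝ :=
  (Fintype.card Ω : ENNReal)⁻¹ • ∑ x, Measure.dirac (X x)

variable {Ω : Type*} [Fintype Ω] (X : Ω → ℝ)

lemma isProbabilityMeasure_uniformLaw [Nonempty Ω] : IsProbabilityMeasure (uniformLaw X) := by
  constructor
  simp only [uniformLaw, Measure.smul_apply, Measure.finsetSum_apply, measure_univ,
    Finset.sum_const, Finset.card_univ, smul_eq_mul, nsmul_eq_mul, mul_one]
  exact ENNReal.inv_mul_cancel (by simp) (by simp)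

lemma charFun_uniformLaw (t : ℝ) :
    charFun (uniformLaw X) t =
      (∑ x, Complex.exp (Complex.I * (t * X x : ℝ))) / (Fintype.card Ω : ℂ) := by
  rw [charFun_apply_real, uniformLaw, integral_smul_measure, integral_finsetSum_measure]
  · simp only [integral_dirac]
    rw [ENNReal.toReal_inv, ENNReal.toReal_natCast, Complex.real_smul, div_eq_inv_mul]
    push_cast
    congr 1
    refine Finset.sum_congr rfl fun x _ => ?_
    congr 1; ring
  · intro x _
    exact integrable_dirac (by simp)

lemma uniformLaw_real_Iic (a : ℝ) :
    (uniformLaw X).real (Set.Iic a) =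
      ((Finset.univ.filter fun x => X x ≤ a).card : ℝ) / Fintype.card Ω := by
  rw [measureReal_def, uniformLaw, Measure.smul_apply, Measure.finsetSum_apply]
  have : ∀ x, Measure.dirac (X x) (Set.Iic a) = if X x ≤ a then 1 else 0 := by
    intro x
    rw [Measure.dirac_apply' _ measurableSet_Iic]
    simp [Set.indicator_apply]
  simp only [this, Finset.sum_boole, smul_eq_mul, ENNReal.toReal_mul, ENNReal.toReal_inv,
    ENNReal.toReal_natCast]
  rw [div_eq_inv_mul]

/-- Lévy's continuity theorem for uniform distributions on finite types, with a standard normal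
limit and varying thresholds. -/
lemma tendsto_card_le_div_of_tendsto_charFun {Ω : ℕ → Type*} [∀ n, Fintype (Ω n)]
    [∀ n, Nonempty (Ω n)] {X : ∀ n, Ω n → ℝ}
    (hX : ∀ t : ℝ, Tendsto (fun n => (∑ x, Complex.exp (Complex.I * (t * X n x : ℝ))) /
      (Fintype.card (Ω n) : ℂ)) atTop (𝓝 (Real.exp (-(t ^ 2 / 2)) : ℂ)))
    {y : ℕ → ℝ} {z : ℝ} (hy : Tendsto y atTop (𝓝 z)) :
    Tendsto (fun n => ((Finset.univ.filter fun x => X n x ≤ y n).card : ℝ) /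
      Fintype.card (Ω n)) atTop (𝓝 (stdNormalCDF z)) := by
  let Y : ∀ n, Ω n → ℝ := fun n x => X n x + (z - y n)
  let μ : ℕ → ProbabilityMeasure ℝ := fun n =>
    ⟨uniformLaw (Y n), isProbabilityMeasure_uniformLaw (Y n)⟩
  let γ : ProbabilityMeasure ℝ := ⟨gaussianReal 0 1, inferInstance⟩
  have hμ : Tendsto μ atTop (𝓝 γ) := by
    rw [ProbabilityMeasure.tendsto_iff_tendsto_charFun]
    intro t
    change Tendsto (fun n => charFun (uniformLaw (Y n)) t) atTop
      (𝓝 (charFun (gaussianReal 0 1) t))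
    have h1 : ∀ n, charFun (uniformLaw (Y n)) t =
        (∑ x, Complex.exp (Complex.I * (t * X n x : ℝ))) / (Fintype.card (Ω n) : ℂ) *
          Complex.exp (Complex.I * (t * (z - y n) : ℝ)) := by
      intro n
      rw [charFun_uniformLaw, div_mul_eq_mul_div, Finset.sum_mul]
      congr 1
      refine Finset.sum_congr rfl fun x _ => ?_
      rw [← Complex.exp_add]
      simp only [Y]
      push_cast
      congr 1; ring
    have h2 : Tendsto (fun n => Complex.exp (Complex.I * (t * (z - y n) : ℝ))) atTop (𝓝 1) := by
      have h3 : Tendsto (fun n => t * (z - y n)) atTop (𝓝 (t * (z - z))) :=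
        (tendsto_const_nhds.sub hy).const_mul t
      have h4 : Continuous fun s : ℝ => Complex.exp (Complex.I * (s : ℂ)) := by fun_prop
      have h5 := (h4.tendsto _).comp h3
      rw [sub_self, mul_zero, Complex.ofReal_zero, mul_zero, Complex.exp_zero] at h5
      exact h5
    simp only [h1]
    convert (hX t).mul h2 using 2
    rw [charFun_gaussianReal, mul_one]
    push_cast
    congr 1
    simp
  have hfr : γ (frontier (Set.Iic z)) = 0 := by
    have : gaussianReal 0 1 (frontier (Set.Iic z)) = 0 := by
      rw [frontier_Iic]
      have := nullSingletonClass_gaussianReal (μ := 0) (v := 1) one_ne_zero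
      exact measure_singleton z
    exact (ProbabilityMeasure.null_iff_toMeasure_null γ _).2 this
  have key := ProbabilityMeasure.tendsto_measure_of_null_frontier_of_tendsto hμ hfr
  have key' := (NNReal.continuous_coe.tendsto _).comp key
  rw [stdNormalCDF_eq_gaussianReal]
  refine key'.congr fun n => ?_
  change (uniformLaw (Y n)).real (Set.Iic z) = _
  rw [uniformLaw_real_Iic]
  congr 3
  ext x
  simp only [Y, Finset.mem_filter]
  constructor <;> rintro ⟨h1, h2⟩ <;> exact ⟨h1, by linarith⟩

end NormalLimit

section Asymptotics

open Topology

lemma tendsto_natCast_succ_atTop : Tendsto (fun n : ℕ => ((n + 1 : ℕ) : ℝ)) atTop atTop :=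
  tendsto_natCast_atTop_atTop.comp (tendsto_add_atTop_nat 1)

lemma tendsto_sqrt_succ_atTop : Tendsto (fun n : ℕ => √((n + 1 : ℕ) : ℝ)) atTop atTop :=
  Real.tendsto_sqrt_atTop.comp tendsto_natCast_succ_atTop

lemma one_sub_one_div_succ_pos {n : ℕ} (hn : 1 ≤ n) : (0 : ℝ) < 1 - 1 / ((n + 1 : ℕ) : ℝ) := by
  have hn' : (1 : ℝ) ≤ n := by exact_mod_cast hn
  rw [sub_pos, div_lt_one (by positivity)]
  push_cast; linarith

lemma succ_mul_log_add_one_nonpos {n : ℕ} (hn : 1 ≤ n) :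
    ((n + 1 : ℕ) : ℝ) * Real.log (1 - 1 / ((n + 1 : ℕ) : ℝ)) + 1 ≤ 0 := by
  have hN : (0 : ℝ) < ((n + 1 : ℕ) : ℝ) := by positivity
  have h := Real.log_le_sub_one_of_pos (one_sub_one_div_succ_pos hn)
  have h' := mul_le_mul_of_nonneg_left h hN.le
  have : ((n + 1 : ℕ) : ℝ) * (1 - 1 / ((n + 1 : ℕ) : ℝ) - 1) = -1 := by field_simp; ring
  linarith

lemma neg_inv_le_succ_mul_log_add_one {n : ℕ} (hn : 1 ≤ n) :
    -(1 / (n : ℝ)) ≤ ((n + 1 : ℕ) : ℝ) * Real.log (1 - 1 / ((n + 1 : ℕ) : ℝ)) + 1 := by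
  have hN : (0 : ℝ) < ((n + 1 : ℕ) : ℝ) := by positivity
  have hn' : (0 : ℝ) < n := by exact_mod_cast hn
  have h := Real.one_sub_inv_le_log_of_pos (one_sub_one_div_succ_pos hn)
  have h' := mul_le_mul_of_nonneg_left h hN.le
  have : ((n + 1 : ℕ) : ℝ) * (1 - (1 - 1 / ((n + 1 : ℕ) : ℝ))⁻¹) = -(1 / n) - 1 := by
    push_cast
    have : (1 - 1 / ((n : ℝ) + 1)) = n / (n + 1) := by field_simp; ring
    rw [this]; field_simp; ring
  linarith

lemma tendsto_sqrt_mul_succ_mul_log_add_one :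
    Tendsto (fun n : ℕ => √((n + 1 : ℕ) : ℝ) *
      (((n + 1 : ℕ) : ℝ) * Real.log (1 - 1 / ((n + 1 : ℕ) : ℝ)) + 1)) atTop (𝓝 0) := by
  have h2 : Tendsto (fun n : ℕ => -(2 / √((n + 1 : ℕ) : ℝ))) atTop (𝓝 0) := by
    simpa using (tendsto_sqrt_succ_atTop.const_div_atTop (2 : ℝ)).neg
  refine tendsto_of_tendsto_of_tendsto_of_le_of_le' h2 tendsto_const_nhds ?_ ?_
  · filter_upwards [eventually_ge_atTop 1] with n hn
    have hn' : (1 : ℝ) ≤ n := by exact_mod_cast hn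
    have hN : (0 : ℝ) < √((n + 1 : ℕ) : ℝ) := by positivity
    refine le_trans ?_ (mul_le_mul_of_nonneg_left (neg_inv_le_succ_mul_log_add_one hn) hN.le)
    rw [mul_neg, neg_le_neg_iff, mul_one_div, div_le_div_iff₀ (by linarith) hN,
      Real.mul_self_sqrt (by positivity)]
    push_cast; linarith
  · filter_upwards [eventually_ge_atTop 1] with n hn
    exact mul_nonpos_of_nonneg_of_nonpos (by positivity) (succ_mul_log_add_one_nonpos hn)

lemma tendsto_succ_mul_log :
    Tendsto (fun n : ℕ => ((n + 1 : ℕ) : ℝ) * Real.log (1 - 1 / ((n + 1 : ℕ) : ℝ)))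
      atTop (𝓝 (-1)) := by
  have h := (tendsto_sqrt_mul_succ_mul_log_add_one.div_atTop tendsto_sqrt_succ_atTop).sub
    (tendsto_const_nhds (x := (1 : ℝ)))
  rw [zero_sub] at h
  refine h.congr fun n => ?_
  have hN : √((n + 1 : ℕ) : ℝ) ≠ 0 := by positivity
  field_simp
  ring

lemma one_sub_one_div_pow_eq_exp {n : ℕ} (hn : 1 ≤ n) (t : ℕ) :
    (1 - 1 / ((n + 1 : ℕ) : ℝ)) ^ t = Real.exp (t * Real.log (1 - 1 / ((n + 1 : ℕ) : ℝ))) := by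
  rw [Real.exp_nat_mul, Real.exp_log (one_sub_one_div_succ_pos hn)]

lemma tendsto_one_sub_one_div_pow {t : ℕ → ℕ} {τ : ℝ}
    (ht : Tendsto (fun n => (t n : ℝ) / ((n + 1 : ℕ) : ℝ)) atTop (𝓝 τ)) :
    Tendsto (fun n : ℕ => (1 - 1 / ((n + 1 : ℕ) : ℝ)) ^ t n) atTop (𝓝 (Real.exp (-τ))) := by
  have h := (Real.continuous_exp.tendsto _).comp (ht.mul tendsto_succ_mul_log)
  rw [mul_neg_one] at h
  refine h.congr' ?_
  filter_upwards [eventually_ge_atTop 1] with n hn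
  rw [one_sub_one_div_pow_eq_exp hn, Function.comp_apply]
  congr 1
  have hN : ((n + 1 : ℕ) : ℝ) ≠ 0 := by positivity
  field_simp

lemma tendsto_mul_exp_sub_one {a δ : ℕ → ℝ} {L : ℝ} (ha : Tendsto a atTop atTop)
    (h : Tendsto (fun n => a n * δ n) atTop (𝓝 L)) :
    Tendsto (fun n => a n * (Real.exp (δ n) - 1)) atTop (𝓝 L) := by
  have hδ : Tendsto δ atTop (𝓝 0) := by
    refine (h.div_atTop ha).congr' ?_
    filter_upwards [ha.eventually_gt_atTop 0] with n hn
    field_simp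
  have h0 : Tendsto (fun n => a n * (Real.exp (δ n) - 1 - δ n)) atTop (𝓝 0) := by
    have hb : Tendsto (fun n => |a n * δ n| * |δ n|) atTop (𝓝 0) := by
      simpa using h.abs.mul hδ.abs
    refine squeeze_zero_norm' ?_ hb
    filter_upwards [hδ.abs.eventually_le_const (show |(0 : ℝ)| < 1 by simp)] with n hn
    have h1 : |Real.exp (δ n) - 1 - δ n| ≤ δ n ^ 2 := Real.abs_exp_sub_one_sub_id_le hn
    rw [Real.norm_eq_abs, abs_mul, abs_mul, mul_assoc, ← sq, sq_abs]
    gcongr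
  have := h0.add h
  rw [zero_add] at this
  exact this.congr fun n => by ring

/-- First order expansion of the expected number of unseen values around the critical time. -/
lemma tendsto_mean_unseen {k : ℕ} (hk : 0 < k) {τ c : ℝ} (hτ : 1 - τ / k - Real.exp (-τ) = 0)
    {s : ℕ → ℕ}
    (hs : Tendsto (fun n => ((s n : ℝ) - τ / k * ((n + 1 : ℕ) : ℝ)) / √((n + 1 : ℕ) : ℝ))
      atTop (𝓝 c)) :
    Tendsto (fun n => (((n + 1 : ℕ) : ℝ) * (1 - 1 / ((n + 1 : ℕ) : ℝ)) ^ (k * s n + 1) -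
      (((n + 1 : ℕ) : ℝ) - s n)) / √((n + 1 : ℕ) : ℝ)) atTop
      (𝓝 (c * (1 - k * Real.exp (-τ)))) := by
  have hk' : (k : ℝ) ≠ 0 := by positivity
  have hδ : Tendsto (fun n => √((n + 1 : ℕ) : ℝ) *
      (((k * s n + 1 : ℕ) : ℝ) * Real.log (1 - 1 / ((n + 1 : ℕ) : ℝ)) + τ)) atTop
      (𝓝 (-(k * c))) := by
    have h1 := (tendsto_sqrt_mul_succ_mul_log_add_one.const_mul τ).add
      (((hs.const_mul (k : ℝ)).mul tendsto_succ_mul_log).add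
        (tendsto_succ_mul_log.div_atTop tendsto_sqrt_succ_atTop))
    have : τ * 0 + (k * c * -1 + 0) = -(k * c) := by ring
    rw [this] at h1
    refine h1.congr fun n => ?_
    have hN : (0 : ℝ) < ((n + 1 : ℕ) : ℝ) := by positivity
    obtain ⟨r, hr, hr'⟩ : ∃ r : ℝ, 0 < r ∧ ((n + 1 : ℕ) : ℝ) = r * r :=
      ⟨√((n + 1 : ℕ) : ℝ), by positivity, (Real.mul_self_sqrt hN.le).symm⟩
    generalize ((n + 1 : ℕ) : ℝ) = M at *
    subst hr'
    rw [Real.sqrt_mul_self hr.le]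
    push_cast
    field_simp
    ring
  have h2 := ((tendsto_mul_exp_sub_one tendsto_sqrt_succ_atTop hδ).const_mul
    (Real.exp (-τ))).add hs
  have : Real.exp (-τ) * -(k * c) + c = c * (1 - k * Real.exp (-τ)) := by ring
  rw [this] at h2
  refine h2.congr' ?_
  filter_upwards [eventually_ge_atTop 1] with n hn
  rw [one_sub_one_div_pow_eq_exp hn, Real.exp_add]
  have hN : (0 : ℝ) < ((n + 1 : ℕ) : ℝ) := by positivity
  obtain ⟨r, hr, hr'⟩ : ∃ r : ℝ, 0 < r ∧ ((n + 1 : ℕ) : ℝ) = r * r :=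
    ⟨√((n + 1 : ℕ) : ℝ), by positivity, (Real.mul_self_sqrt hN.le).symm⟩
  have h3 : Real.exp (-τ) = 1 - τ / k := by linarith
  have h4 : Real.exp (-τ) * Real.exp τ = 1 := by rw [← Real.exp_add]; simp
  generalize Real.exp (((k * s n + 1 : ℕ) : ℝ) * Real.log (1 - 1 / ((n + 1 : ℕ) : ℝ))) = E
  generalize ((n + 1 : ℕ) : ℝ) = M at *
  subst hr'
  rw [Real.sqrt_mul_self hr.le, eq_div_iff hr.ne', add_mul, div_mul_cancel₀ _ hr.ne']
  have : Real.exp (-τ) * (r * (E * Real.exp τ - 1)) * r =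
      r * r * (E * (Real.exp (-τ) * Real.exp τ) - Real.exp (-τ)) := by ring
  rw [this, h4, h3]
  ring

/-- The asymptotic variance of the number of unseen values. -/
noncomputable def occupancyVar (τ : ℝ) : ℝ :=
  Real.exp (-τ) - (1 + τ) * Real.exp (-(2 * τ))

lemma occupancyVar_pos {τ : ℝ} (hτ : 0 < τ) : 0 < occupancyVar τ := by
  have h1 : τ + 1 < Real.exp τ := Real.add_one_lt_exp hτ.ne'
  have h2 : Real.exp (-τ) = Real.exp τ * Real.exp (-(2 * τ)) := by
    rw [← Real.exp_add]; congr 1; ring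
  rw [occupancyVar, h2, ← sub_mul]
  exact mul_pos (by linarith) (Real.exp_pos _)

lemma tendsto_unseenVar_div {t : ℕ → ℕ} {τ : ℝ}
    (ht : Tendsto (fun n => (t n : ℝ) / ((n + 1 : ℕ) : ℝ)) atTop (𝓝 τ)) :
    Tendsto (fun n => unseenVar (n + 1) (t n) / ((n + 1 : ℕ) : ℝ)) atTop
      (𝓝 (occupancyVar τ)) := by
  have h1 := tendsto_one_sub_one_div_pow ht
  have h2 : Tendsto (fun n : ℕ => (1 - 1 / ((n + 1 : ℕ) : ℝ)) ^ (2 * t n)) atTop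
      (𝓝 (Real.exp (-(2 * τ)))) := by
    refine tendsto_one_sub_one_div_pow ((ht.const_mul 2).congr fun n => ?_)
    push_cast; ring
  refine (h1.sub ((ht.const_add 1).mul h2)).congr fun n => ?_
  have hN : ((n + 1 : ℕ) : ℝ) ≠ 0 := by positivity
  rw [unseenVar]
  field_simp

end Asymptotics

section OccupancyLimit

open Topology

lemma tendsto_unseen_charFun_error {t : ℕ → ℕ} {τ : ℝ} (p : ℝ)
    (ht : Tendsto (fun n => (t n : ℝ) / ((n + 1 : ℕ) : ℝ)) atTop (𝓝 τ)) :
    Tendsto (fun n => (t n : ℝ) * (|p / √((n + 1 : ℕ) : ℝ)| ^ 3 + (p / √((n + 1 : ℕ) : ℝ)) ^ 4 +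
      (p / √((n + 1 : ℕ) : ℝ)) ^ 2 * (√(t n) / ((n + 1 : ℕ) : ℝ)))) atTop (𝓝 0) := by
  have h1 : Tendsto (fun n : ℕ => 1 / √((n + 1 : ℕ) : ℝ)) atTop (𝓝 0) :=
    tendsto_sqrt_succ_atTop.const_div_atTop 1
  have h2 : Tendsto (fun n => √((t n : ℝ) / ((n + 1 : ℕ) : ℝ))) atTop (𝓝 √τ) :=
    (Real.continuous_sqrt.tendsto _).comp ht
  have h3 := ht.mul (((h1.const_mul (|p| ^ 3)).add ((h1.mul h1).const_mul (p ^ 4))).add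
    ((h1.mul h2).const_mul (p ^ 2)))
  simp only [mul_zero, zero_mul, add_zero] at h3
  refine h3.congr fun n => ?_
  have hN : (0 : ℝ) < ((n + 1 : ℕ) : ℝ) := by positivity
  rw [Real.sqrt_div' _ hN.le]
  obtain ⟨r, hr, hr'⟩ : ∃ r : ℝ, 0 < r ∧ ((n + 1 : ℕ) : ℝ) = r * r :=
    ⟨√((n + 1 : ℕ) : ℝ), by positivity, (Real.mul_self_sqrt hN.le).symm⟩
  generalize ((n + 1 : ℕ) : ℝ) = M at *
  subst hr'
  rw [Real.sqrt_mul_self hr.le, abs_div, abs_of_pos hr]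
  field_simp

/-- Central limit theorem for the number of unseen values. -/
lemma tendsto_prob_le_unseen {k : ℕ} {D : ∀ n, Finset (Fin (n + 1))} (hD : ∀ n, (D n).card = 1)
    {A : ∀ n, Finset (Fin (n + 1) × Fin k)} {τ : ℝ} (hτ : 0 < τ)
    (hA : Tendsto (fun n => ((A n).card : ℝ) / ((n + 1 : ℕ) : ℝ)) atTop (𝓝 τ))
    {a : ℕ → ℝ} {z : ℝ}
    (ha : Tendsto (fun n => (((n + 1 : ℕ) : ℝ) * (1 - 1 / ((n + 1 : ℕ) : ℝ)) ^ ((A n).card + 1) -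
      a n) / √((n + 1 : ℕ) : ℝ)) atTop (𝓝 z)) :
    Tendsto (fun n => prob (n + 1) k (fun x => a n ≤ unseen (D n) (A n) x)) atTop
      (𝓝 (stdNormalCDF (z / √(occupancyVar τ)))) := by
  have hw := occupancyVar_pos hτ
  have hw' : 0 < √(occupancyVar τ) := Real.sqrt_pos.2 hw
  have hne : ∀ n : ℕ, Nonempty (Fin (n + 1) × Fin k → Fin (n + 1)) := fun n => ⟨fun _ => 0⟩
  let m : ℕ → ℝ := fun n =>
    ((n + 1 : ℕ) : ℝ) * (1 - 1 / ((n + 1 : ℕ) : ℝ)) ^ ((A n).card + 1)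
  let X : ∀ n, (Fin (n + 1) × Fin k → Fin (n + 1)) → ℝ := fun n x =>
    (m n - unseen (D n) (A n) x) / √((n + 1 : ℕ) : ℝ) / √(occupancyVar τ)
  have hX : ∀ t : ℝ, Tendsto (fun n => (∑ x, Complex.exp (Complex.I * (t * X n x : ℝ))) /
      (Fintype.card (Fin (n + 1) × Fin k → Fin (n + 1)) : ℂ)) atTop
      (𝓝 (Real.exp (-(t ^ 2 / 2)) : ℂ)) := by
    intro t
    let θ : ℕ → ℝ := fun n => -t / √(occupancyVar τ) / √((n + 1 : ℕ) : ℝ)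
    have hmain : Tendsto (fun n => (Real.exp (-((θ n) ^ 2 * unseenVar (n + 1) (A n).card / 2)) : ℂ))
        atTop (𝓝 (Real.exp (-(t ^ 2 / 2)) : ℂ)) := by
      refine (Complex.continuous_ofReal.tendsto _).comp ((Real.continuous_exp.tendsto _).comp
        (Tendsto.neg (Tendsto.div_const ?_ 2)))
      have h1 := (tendsto_unseenVar_div hA).const_mul (t ^ 2 / occupancyVar τ)
      rw [div_mul_cancel₀ _ hw.ne'] at h1
      refine h1.congr fun n => ?_
      simp only [θ]
      rw [div_pow, div_pow, Real.sq_sqrt hw.le, Real.sq_sqrt (by positivity)]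
      ring
    have herr := tendsto_unseen_charFun_error (-t / √(occupancyVar τ)) hA
    rw [← tendsto_sub_nhds_zero_iff] at hmain ⊢
    have hd : Tendsto (fun n => (∑ x, Complex.exp (Complex.I * (t * X n x : ℝ))) /
        (Fintype.card (Fin (n + 1) × Fin k → Fin (n + 1)) : ℂ) -
        (Real.exp (-((θ n) ^ 2 * unseenVar (n + 1) (A n).card / 2)) : ℂ)) atTop (𝓝 0) := by
      refine squeeze_zero_norm (fun n => ?_) herr
      have hc : (0 : ℝ) < Fintype.card (Fin (n + 1) × Fin k → Fin (n + 1)) :=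
        card_fun_pos (Nat.succ_pos n)
      have hb := norm_sum_exp_unseen_sub_le (Nat.succ_pos n) (hD n) (A n) (θ n)
      have hs : ∀ x, θ n * (unseen (D n) (A n) x - ((n + 1 : ℕ) : ℝ) *
          (1 - 1 / ((n + 1 : ℕ) : ℝ)) ^ ((A n).card + 1)) = t * X n x := by
        intro x; simp only [θ, X, m]; ring
      simp only [Nat.succ_eq_add_one, hs] at hb
      have hcC : (Fintype.card (Fin (n + 1) × Fin k → Fin (n + 1)) : ℂ) ≠ 0 := by
        exact_mod_cast hc.ne'
      rw [div_sub' hcC, norm_div, Complex.norm_natCast, div_le_iff₀ hc]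
      refine hb.trans (le_of_eq ?_)
      simp only [θ]
      ring
    have := hd.add hmain
    rw [add_zero] at this
    exact this.congr fun n => by ring
  have key := tendsto_card_le_div_of_tendsto_charFun hX (ha.div_const √(occupancyVar τ))
  refine key.congr fun n => ?_
  unfold prob
  congr 3
  ext x
  simp only [X, m, Finset.mem_filter, Finset.mem_univ, true_and]
  have hN : (0 : ℝ) < √((n + 1 : ℕ) : ℝ) := by positivity
  rw [div_le_div_iff_of_pos_right hw', div_le_div_iff_of_pos_right hN, sub_le_sub_iff_left]

end OccupancyLimit

section Parameters

variable {k : ℕ} {τ : ℝ}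

lemma mul_exp_neg_lt_one (hk : 0 < k) (hτpos : 0 < τ) (hτ : 1 - τ / k - Real.exp (-τ) = 0) :
    k * Real.exp (-τ) < 1 := by
  have hk' : (0 : ℝ) < k := by exact_mod_cast hk
  have h1 : τ + 1 < Real.exp τ := Real.add_one_lt_exp hτpos.ne'
  have h2 : Real.exp τ * Real.exp (-τ) = 1 := by rw [← Real.exp_add]; simp
  have h3 : (τ + 1) * Real.exp (-τ) < 1 := by
    exact (mul_lt_mul_of_pos_right h1 (Real.exp_pos _)).trans_eq h2
  have h4 : τ * (k * Real.exp (-τ)) < τ * 1 := by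
    have : k * (τ * Real.exp (-τ)) < k * (τ / k) := mul_lt_mul_of_pos_left (by linarith) hk'
    rw [mul_div_cancel₀ _ hk'.ne'] at this
    linarith
  exact lt_of_mul_lt_mul_left h4 hτpos.le

lemma half_lt_div (hk : 2 ≤ k) (hτpos : 0 < τ) (hτ : 1 - τ / k - Real.exp (-τ) = 0) :
    1 / 2 < τ / k := by
  have hk' : (2 : ℝ) ≤ k := by exact_mod_cast hk
  have h := mul_exp_neg_lt_one (by omega) hτpos hτ
  have h2 : 2 * Real.exp (-τ) ≤ k * Real.exp (-τ) :=
    mul_le_mul_of_nonneg_right hk' (Real.exp_pos _).le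
  linarith

lemma sqrt_mul_eq_sqrt_occupancyVar (hk : 0 < k) (hτpos : 0 < τ)
    (hτ : 1 - τ / k - Real.exp (-τ) = 0) :
    √(τ / (k * Real.exp τ * (1 - k * Real.exp (-τ)))) * (1 - k * Real.exp (-τ)) =
      √(occupancyVar τ) := by
  have hk' : (0 : ℝ) < k := by exact_mod_cast hk
  have h := mul_exp_neg_lt_one hk hτpos hτ
  have h0 : 0 < 1 - k * Real.exp (-τ) := by linarith
  have h2 : Real.exp τ = (Real.exp (-τ))⁻¹ := by rw [Real.exp_neg, inv_inv]
  rw [← Real.sqrt_sq h0.le, ← Real.sqrt_mul (by positivity), Real.sqrt_sq h0.le]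
  congr 1
  have h3 : Real.exp (-(2 * τ)) = Real.exp (-τ) * Real.exp (-τ) := by
    rw [← Real.exp_add]; congr 1; ring
  have h4 : k * Real.exp (-τ) = k - τ := by
    have : Real.exp (-τ) = 1 - τ / k := by linarith
    rw [this]; field_simp
  rw [occupancyVar, h3, h2, h4]
  rw [h4] at h0
  have h5 : Real.exp (-τ) = (k - τ) / k := by rw [eq_div_iff hk'.ne']; linarith
  have h6 : (k : ℝ) - τ ≠ 0 := by
    rw [← h4]; positivity
  rw [h5]
  field_simp
  ring

end Parameters

section Restart

open Topology

lemma add_mul_le_mul_pow {a M q η : ℝ} {k : ℕ} (ha : 0 < a) (hM : 0 < M) (hq : 0 < q)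
    (hη : η ≤ a * (Real.log (1 + M / a) / M + k * Real.log q)) {m : ℕ} (hm : m ≤ M) :
    a + η * m ≤ (a + m) * q ^ (k * m) := by
  have h1M : 0 < 1 + M / a := by positivity
  have h1 : Real.exp (Real.log (1 + M / a) * (m / M)) ≤ 1 + m / a := by
    have h := rpow_one_add_le_one_add_mul_self (s := M / a) (p := m / M)
      (by linarith [show 0 < M / a by positivity]) (by positivity) (by rwa [div_le_one hM])
    rw [Real.rpow_def_of_pos h1M] at h
    refine h.trans (le_of_eq ?_)
    field_simp
  have h2 : q ^ (k * m) = Real.exp (k * m * Real.log q) := by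
    rw [← Nat.cast_mul, Real.exp_nat_mul, Real.exp_log hq]
  calc a + η * m ≤ a + a * (Real.log (1 + M / a) / M + k * Real.log q) * m := by gcongr
    _ = a * ((Real.log (1 + M / a) * (m / M) + k * m * Real.log q) + 1) := by field_simp; ring
    _ ≤ a * Real.exp (Real.log (1 + M / a) * (m / M) + k * m * Real.log q) := by
        gcongr; exact Real.add_one_le_exp _
    _ = a * (Real.exp (Real.log (1 + M / a) * (m / M)) * q ^ (k * m)) := by
        rw [Real.exp_add, h2]
    _ ≤ a * ((1 + m / a) * q ^ (k * m)) := by gcongr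
    _ = (a + m) * q ^ (k * m) := by field_simp

/-- Around the critical time, exploration that stops after linearly many steps would typically
have been followed by a linear excess of unseen values. -/
lemma exists_eventually_add_mul_le_mul_pow {k : ℕ} (hk : 2 ≤ k) {τ : ℝ} (hτpos : 0 < τ)
    (hτ : 1 - τ / k - Real.exp (-τ) = 0) {s : ℕ → ℕ}
    (hs : Tendsto (fun n => (s n : ℝ) / ((n + 1 : ℕ) : ℝ)) atTop (𝓝 (τ / k))) :
    ∃ η : ℝ, 0 < η ∧ ∀ᶠ n in atTop, ∀ j : ℕ, j ≤ s n → n + 1 < 6 * j →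
      ((n + 1 : ℕ) : ℝ) - s n + η * (s n - j) ≤
        (((n + 1 : ℕ) : ℝ) - j) * (1 - 1 / ((n + 1 : ℕ) : ℝ)) ^ (k * (s n - j)) := by
  have hk' : (2 : ℝ) ≤ k := by exact_mod_cast hk
  have hν := half_lt_div hk hτpos hτ
  have hα : Real.exp (-τ) = 1 - τ / k := by linarith
  have hα0 : 0 < 1 - τ / k := hα ▸ Real.exp_pos _
  have hM0 : 0 < τ / k - 1 / 6 := by linarith
  have hlog : Real.log (1 + (τ / k - 1 / 6) / (1 - τ / k)) = Real.log (5 / 6) + τ := by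
    have : 1 + (τ / k - 1 / 6) / (1 - τ / k) = (5 / 6) * Real.exp τ := by
      have h2 : Real.exp (-τ) * Real.exp τ = 1 := by rw [← Real.exp_add]; simp
      rw [hα] at h2
      have : Real.exp τ = 1 / (1 - τ / k) := by rw [eq_div_iff hα0.ne']; linarith
      rw [this]
      generalize τ / k = ν at *
      field_simp
      ring
    rw [this, Real.log_mul (by norm_num) (Real.exp_pos _).ne', Real.log_exp]
  set L := (1 - τ / k) * (Real.log (5 / 6) + τ) / (τ / k - 1 / 6) - (1 - τ / k) * k with hL
  have hLpos : 0 < L := by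
    have h56 : 1 - (5 / 6 : ℝ)⁻¹ ≤ Real.log (5 / 6) := Real.one_sub_inv_le_log_of_pos (by norm_num)
    have : k * (τ / k - 1 / 6) < Real.log (5 / 6) + τ := by
      rw [mul_sub, mul_div_cancel₀ _ (by positivity)]
      norm_num at h56 ⊢
      linarith
    rw [hL, mul_div_assoc, ← mul_sub]
    refine mul_pos hα0 ?_
    rw [sub_pos, lt_div_iff₀ hM0]
    exact this
  have ha : Tendsto (fun n => (((n + 1 : ℕ) : ℝ) - s n) / ((n + 1 : ℕ) : ℝ)) atTop
      (𝓝 (1 - τ / k)) := by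
    refine (hs.const_sub 1).congr fun n => ?_
    field_simp
  have hM : Tendsto (fun n => ((s n : ℝ) - ((n + 1 : ℕ) : ℝ) / 6) / ((n + 1 : ℕ) : ℝ)) atTop
      (𝓝 (τ / k - 1 / 6)) := by
    refine (hs.sub_const (1 / 6)).congr fun n => ?_
    field_simp
  have hlim : Tendsto (fun n : ℕ => (((n + 1 : ℕ) : ℝ) - s n) *
      (Real.log (1 + (s n - ((n + 1 : ℕ) : ℝ) / 6) / (((n + 1 : ℕ) : ℝ) - s n)) /
        (s n - ((n + 1 : ℕ) : ℝ) / 6) + k * Real.log (1 - 1 / ((n + 1 : ℕ) : ℝ)))) atTop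
      (𝓝 L) := by
    have h1 : Tendsto (fun n : ℕ => Real.log (1 + (s n - ((n + 1 : ℕ) : ℝ) / 6) /
        (((n + 1 : ℕ) : ℝ) - s n))) atTop (𝓝 (Real.log (5 / 6) + τ)) := by
      rw [← hlog]
      refine Tendsto.log ?_ (by positivity)
      refine ((hM.div ha hα0.ne').const_add 1).congr fun n => ?_
      simp only [Pi.div_apply]
      rw [div_div_div_cancel_right₀ (by positivity)]
    have h2 := ((ha.mul h1).div hM hM0.ne').add ((ha.mul_const (k : ℝ)).mul tendsto_succ_mul_log)
    have : (1 - τ / k) * (Real.log (5 / 6) + τ) / (τ / k - 1 / 6) + (1 - τ / k) * k * -1 = L := by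
      rw [hL]; ring
    rw [this] at h2
    refine h2.congr fun n => ?_
    have hN : ((n + 1 : ℕ) : ℝ) ≠ 0 := by positivity
    simp only [Pi.div_apply]
    generalize Real.log (1 + (s n - ((n + 1 : ℕ) : ℝ) / 6) / (((n + 1 : ℕ) : ℝ) - s n)) = A
    generalize Real.log (1 - 1 / ((n + 1 : ℕ) : ℝ)) = B
    generalize (s n : ℝ) - ((n + 1 : ℕ) : ℝ) / 6 = C
    generalize (((n + 1 : ℕ) : ℝ) - s n) = D
    generalize ((n + 1 : ℕ) : ℝ) = E at *
    rw [div_mul_eq_mul_div, div_div_div_cancel_right₀ hN]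
    field_simp
  refine ⟨L / 2, by positivity, ?_⟩
  filter_upwards [hlim.eventually_const_le (show L / 2 < L by linarith),
    ha.eventually_const_lt hα0, hM.eventually_const_lt hM0, eventually_ge_atTop 1]
    with n h1 h2 h3 h4 j hj hj6
  have hN : (0 : ℝ) < ((n + 1 : ℕ) : ℝ) := by positivity
  have h2' : 0 < ((n + 1 : ℕ) : ℝ) - s n := by
    by_contra h
    exact absurd h2 (not_lt.2 (div_nonpos_of_nonpos_of_nonneg (not_lt.1 h) hN.le))
  have h3' : 0 < (s n : ℝ) - ((n + 1 : ℕ) : ℝ) / 6 := by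
    by_contra h
    exact absurd h3 (not_lt.2 (div_nonpos_of_nonpos_of_nonneg (not_lt.1 h) hN.le))
  have hj6' : ((n + 1 : ℕ) : ℝ) < 6 * j := by exact_mod_cast hj6
  have := add_mul_le_mul_pow (k := k) (m := s n - j) h2' h3' (one_sub_one_div_succ_pos h4) h1
    (by rw [Nat.cast_sub hj]; linarith)
  rw [Nat.cast_sub hj] at this
  refine this.trans (le_of_eq ?_)
  ring

end Restart

section Sandwich

open Topology

/-- A sequence squeezed between families of sequences with close limits converges. -/
lemma tendsto_of_forall_eventually_le {f : ℕ → ℝ} {l g : ℝ → ℕ → ℝ} {L G : ℝ → ℝ} {a : ℝ}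
    (hL : Tendsto L (𝓝[>] 0) (𝓝 a)) (hG : Tendsto G (𝓝[>] 0) (𝓝 a))
    (hl : ∀ δ > 0, Tendsto (l δ) atTop (𝓝 (L δ))) (hg : ∀ δ > 0, Tendsto (g δ) atTop (𝓝 (G δ)))
    (hlf : ∀ δ > 0, ∀ᶠ n in atTop, l δ n ≤ f n) (hfg : ∀ δ > 0, ∀ᶠ n in atTop, f n ≤ g δ n) :
    Tendsto f atTop (𝓝 a) := by
  rw [tendsto_order]
  constructor
  · intro b hb
    obtain ⟨δ, hδ, hδ0⟩ := ((hL.eventually_const_lt hb).and self_mem_nhdsWithin).exists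
    filter_upwards [(hl δ hδ0).eventually_const_lt hδ, hlf δ hδ0] with n h1 h2
    linarith
  · intro b hb
    obtain ⟨δ, hδ, hδ0⟩ := ((hG.eventually_lt_const hb).and self_mem_nhdsWithin).exists
    filter_upwards [(hg δ hδ0).eventually_lt_const hδ, hfg δ hδ0] with n h1 h2
    linarith

end Sandwich

section ReachLimit

open Topology

lemma tendsto_const_div_succ (a : ℝ) :
    Tendsto (fun n : ℕ => a / ((n + 1 : ℕ) : ℝ)) atTop (𝓝 0) :=
  tendsto_natCast_succ_atTop.const_div_atTop a

lemma eventually_linear_add_sqrt_nonneg {ν : ℝ} (hν : 0 < ν) (c : ℝ) :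
    ∀ᶠ n : ℕ in atTop, 0 ≤ ν * ((n + 1 : ℕ) : ℝ) + c * √((n + 1 : ℕ) : ℝ) := by
  filter_upwards [(tendsto_sqrt_succ_atTop.const_mul_atTop hν).eventually_ge_atTop (-c)] with n hn
  have hN : (0 : ℝ) ≤ ((n + 1 : ℕ) : ℝ) := by positivity
  have : ν * ((n + 1 : ℕ) : ℝ) + c * √((n + 1 : ℕ) : ℝ) =
      (ν * √((n + 1 : ℕ) : ℝ) + c) * √((n + 1 : ℕ) : ℝ) := by
    rw [add_mul, mul_assoc, Real.mul_self_sqrt hN]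
  rw [this]
  exact mul_nonneg (by linarith) (Real.sqrt_nonneg _)

lemma tendsto_floor_linear_add_sqrt {ν : ℝ} (hν : 0 < ν) (c : ℝ) :
    Tendsto (fun n : ℕ => ((⌊ν * ((n + 1 : ℕ) : ℝ) + c * √((n + 1 : ℕ) : ℝ)⌋₊ : ℝ) -
      ν * ((n + 1 : ℕ) : ℝ)) / √((n + 1 : ℕ) : ℝ)) atTop (𝓝 c) := by
  have h1 : Tendsto (fun n : ℕ => c - 1 / √((n + 1 : ℕ) : ℝ)) atTop (𝓝 c) := by
    simpa using (tendsto_sqrt_succ_atTop.const_div_atTop (1 : ℝ)).const_sub c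
  refine tendsto_of_tendsto_of_tendsto_of_le_of_le' h1 tendsto_const_nhds ?_ ?_
  · filter_upwards with n
    have hN : (0 : ℝ) < √((n + 1 : ℕ) : ℝ) := by positivity
    have h := Nat.lt_floor_add_one (ν * ((n + 1 : ℕ) : ℝ) + c * √((n + 1 : ℕ) : ℝ))
    rw [le_div_iff₀ hN, sub_mul, div_mul_cancel₀ _ hN.ne']
    linarith
  · filter_upwards [eventually_linear_add_sqrt_nonneg hν c] with n hn
    have hN : (0 : ℝ) < √((n + 1 : ℕ) : ℝ) := by positivity
    have h := Nat.floor_le hn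
    rw [div_le_iff₀ hN]
    linarith

lemma tendsto_div_of_tendsto_sub_div_sqrt {s : ℕ → ℕ} {ν c : ℝ}
    (hs : Tendsto (fun n => ((s n : ℝ) - ν * ((n + 1 : ℕ) : ℝ)) / √((n + 1 : ℕ) : ℝ))
      atTop (𝓝 c)) :
    Tendsto (fun n => (s n : ℝ) / ((n + 1 : ℕ) : ℝ)) atTop (𝓝 ν) := by
  have h := (hs.div_atTop tendsto_sqrt_succ_atTop).add_const ν
  rw [zero_add] at h
  refine h.congr fun n => ?_
  have hN : (0 : ℝ) < ((n + 1 : ℕ) : ℝ) := by positivity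
  rw [div_div, Real.mul_self_sqrt hN.le]
  field_simp
  ring

lemma tendsto_prob_le_unseen_firstRows {k : ℕ} (hk : 2 ≤ k) {τ c : ℝ} (hτpos : 0 < τ)
    (hτ : 1 - τ / k - Real.exp (-τ) = 0) (u : ∀ n, Fin (n + 1)) {s : ℕ → ℕ}
    (hs : Tendsto (fun n => ((s n : ℝ) - τ / k * ((n + 1 : ℕ) : ℝ)) / √((n + 1 : ℕ) : ℝ))
      atTop (𝓝 c)) (δ : ℝ) :
    Tendsto (fun n => prob (n + 1) k (fun x => ((n + 1 : ℕ) : ℝ) - s n - δ * √((n + 1 : ℕ) : ℝ) ≤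
      unseen {u n} (firstRows (n + 1) k (s n)) x)) atTop
      (𝓝 (stdNormalCDF ((c * (1 - k * Real.exp (-τ)) + δ) / √(occupancyVar τ)))) := by
  have hk' : (k : ℝ) ≠ 0 := by positivity
  have hs1 := tendsto_div_of_tendsto_sub_div_sqrt hs
  have hν1 : τ / k < 1 := by linarith [Real.exp_pos (-τ)]
  have hcard : ∀ᶠ n in atTop, (firstRows (n + 1) k (s n)).card = k * s n := by
    filter_upwards [hs1.eventually_lt_const hν1] with n hn
    refine card_firstRows ?_
    rw [div_lt_one (by positivity)] at hn
    exact_mod_cast hn.le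
  refine tendsto_prob_le_unseen (fun n => Finset.card_singleton _) hτpos ?_ ?_
  · have := hs1.const_mul (k : ℝ)
    rw [mul_div_cancel₀ _ hk'] at this
    refine this.congr' ?_
    filter_upwards [hcard] with n hn
    rw [hn]; push_cast; ring
  · refine ((tendsto_mean_unseen (by omega) hτ hs).add_const δ).congr' ?_
    filter_upwards [hcard] with n hn
    rw [hn]
    have hN : √((n + 1 : ℕ) : ℝ) ≠ 0 := by positivity
    field_simp
    ring

/-- Central limit theorem for the number of vertices reachable from a given vertex. -/
lemma tendsto_prob_card_reachSet_le {k : ℕ} (hk : 2 ≤ k) {τ : ℝ} (hτpos : 0 < τ)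
    (hτ : 1 - τ / k - Real.exp (-τ) = 0) (u : ∀ n, Fin (n + 1)) (c : ℝ) :
    Tendsto (fun n => prob (n + 1) k (fun f => ((reachSet f (u n)).card : ℝ) ≤
      τ / k * ((n + 1 : ℕ) : ℝ) + c * √((n + 1 : ℕ) : ℝ))) atTop
      (𝓝 (stdNormalCDF (c * (1 - k * Real.exp (-τ)) / √(occupancyVar τ)))) := by
  have hν : 0 < τ / k := by linarith [half_lt_div hk hτpos hτ]
  have hν1 : τ / k < 1 := by linarith [Real.exp_pos (-τ)]
  obtain ⟨s, hsdef⟩ : ∃ s : ℕ → ℕ, ∀ n, s n =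
    ⌊τ / k * ((n + 1 : ℕ) : ℝ) + c * √((n + 1 : ℕ) : ℝ)⌋₊ := ⟨_, fun n => rfl⟩
  have hs := tendsto_floor_linear_add_sqrt hν c
  simp only [← hsdef] at hs
  have hs1 := tendsto_div_of_tendsto_sub_div_sqrt hs
  have hsle : ∀ᶠ n in atTop, s n ≤ n + 1 := by
    filter_upwards [hs1.eventually_lt_const hν1] with n hn
    rw [div_lt_one (by positivity)] at hn
    exact_mod_cast hn.le
  have heq : ∀ᶠ n in atTop, prob (n + 1) k (fun f => ((reachSet f (u n)).card : ℝ) ≤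
      τ / k * ((n + 1 : ℕ) : ℝ) + c * √((n + 1 : ℕ) : ℝ)) =
      prob (n + 1) k (fun x => hittingRow (u n) x ≤ s n) := by
    filter_upwards [eventually_linear_add_sqrt_nonneg hν c] with n hn
    rw [← prob_card_reachSet (u n) (fun j => j ≤ s n)]
    simp only [hsdef, Nat.le_floor_iff hn]
  rw [tendsto_congr' heq]
  obtain ⟨η, hη, hJ⟩ := exists_eventually_add_mul_le_mul_pow hk hτpos hτ hs1
  have hcont : Tendsto (fun δ : ℝ =>
      stdNormalCDF ((c * (1 - k * Real.exp (-τ)) + δ) / √(occupancyVar τ))) (𝓝[>] 0)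
      (𝓝 (stdNormalCDF (c * (1 - k * Real.exp (-τ)) / √(occupancyVar τ)))) := by
    have h : Continuous fun δ : ℝ =>
        stdNormalCDF ((c * (1 - k * Real.exp (-τ)) + δ) / √(occupancyVar τ)) :=
      continuous_stdNormalCDF.comp (by fun_prop)
    have h' := h.tendsto 0
    rw [add_zero] at h'
    exact h'.mono_left nhdsWithin_le_nhds
  refine tendsto_of_forall_eventually_le
    (l := fun _ n => prob (n + 1) k (fun x => ((n + 1 : ℕ) : ℝ) - s n - 0 * √((n + 1 : ℕ) : ℝ) ≤
      unseen {u n} (firstRows (n + 1) k (s n)) x))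
    (g := fun δ n => 12 / ((n + 1 : ℕ) : ℝ) +
      (prob (n + 1) k (fun x => ((n + 1 : ℕ) : ℝ) - s n - δ * √((n + 1 : ℕ) : ℝ) ≤
        unseen {u n} (firstRows (n + 1) k (s n)) x) +
      k / (16 * η * δ) / √((n + 1 : ℕ) : ℝ)))
    tendsto_const_nhds hcont (fun δ _ => ?_) (fun δ _ => ?_) (fun δ _ => ?_) (fun δ hδ => ?_)
  · have := tendsto_prob_le_unseen_firstRows hk hτpos hτ u hs 0
    rwa [add_zero] at this
  · have := (tendsto_const_div_succ 12).add
      ((tendsto_prob_le_unseen_firstRows hk hτpos hτ u hs δ).add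
        (tendsto_sqrt_succ_atTop.const_div_atTop (k / (16 * η * δ))))
    rwa [zero_add, add_zero] at this
  · filter_upwards with n
    refine prob_mono fun x hx => hittingRow_le ?_
    rw [unseen_firstRows, zero_mul, sub_zero, sub_le_sub_iff_left] at hx
    exact_mod_cast hx
  · filter_upwards [hJ, hsle] with n hn hsn
    have hN : (0 : ℝ) < √((n + 1 : ℕ) : ℝ) := by positivity
    have h1 : prob (n + 1) k (fun x => 6 * hittingRow (u n) x ≤ n + 1) ≤
        12 / ((n + 1 : ℕ) : ℝ) := by
      rw [← prob_card_reachSet (u n) (fun j => 6 * j ≤ n + 1)]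
      refine (prob_mono fun f hf => ?_).trans
        (prob_exists_small_isClosedSet_le (Nat.succ_pos n) hk)
      exact ⟨reachSet f (u n), ⟨u n, self_mem_reachSet _⟩, hf, isClosedSet_reachSet _⟩
    have h2 := prob_hittingRow_mem_unseen_lt_le (k := k) (Nat.succ_pos n) (u n) hsn
      ((Finset.range (s n + 1)).filter fun j => n + 1 < 6 * j) hη (mul_pos hδ hN)
      (fun j hj => by
        rw [Finset.mem_filter, Finset.mem_range, Nat.lt_succ_iff] at hj
        exact ⟨hj.1, hn j hj.1 hj.2⟩)
    refine (prob_mono (Q := fun x => 6 * hittingRow (u n) x ≤ n + 1 ∨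
      (((n + 1 : ℕ) : ℝ) - s n - δ * √((n + 1 : ℕ) : ℝ) ≤
        unseen {u n} (firstRows (n + 1) k (s n)) x ∨
      (hittingRow (u n) x ∈ (Finset.range (s n + 1)).filter (fun j => n + 1 < 6 * j) ∧
        unseen {u n} (firstRows (n + 1) k (s n)) x <
          ((n + 1 : ℕ) : ℝ) - s n - δ * √((n + 1 : ℕ) : ℝ)))) fun x hx => ?_).trans
      (prob_or_le.trans (add_le_add h1 (prob_or_le.trans (
        add_le_add le_rfl (h2.trans (le_of_eq ?_))))))
    · by_cases h6 : 6 * hittingRow (u n) x ≤ n + 1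
      · exact Or.inl h6
      · refine Or.inr ((le_or_gt _ _).imp id fun h => ⟨?_, h⟩)
        rw [Finset.mem_filter, Finset.mem_range]
        omega
    · rw [div_div, mul_assoc (16 * η)]

end ReachLimit

section Comparison

variable {n k : ℕ}

/-- The total difference between the set reachable from `v` and the sets reachable from the other
vertices, where only sets with at least `b` elements count. -/
noncomputable def reachDiscrepancy (b : ℝ) (v : Fin n) (f : Fin n × Fin k → Fin n) : ℝ :=
  ∑ u, ((if b ≤ (reachSet f u).card then ((reachSet f v \ reachSet f u).card : ℝ) else 0) +
    if b ≤ (reachSet f v).card then ((reachSet f u \ reachSet f v).card : ℝ) else 0)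

lemma reachDiscrepancy_summand_nonneg (b : ℝ) (u v : Fin n) (f : Fin n × Fin k → Fin n) :
    0 ≤ (if b ≤ (reachSet f u).card then ((reachSet f v \ reachSet f u).card : ℝ) else 0) +
      if b ≤ (reachSet f v).card then ((reachSet f u \ reachSet f v).card : ℝ) else 0 := by
  positivity

lemma sum_reachDiscrepancy_le (hn : 0 < n) (v : Fin n) {b ρ : ℝ} (hρ : ρ < 1)
    (hb : k * (n - b) ≤ ρ * n) :
    ∑ f : Fin n × Fin k → Fin n, reachDiscrepancy b v f ≤
      2 * n / (1 - ρ) * Fintype.card (Fin n × Fin k → Fin n) := by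
  unfold reachDiscrepancy
  rw [Finset.sum_comm]
  simp only [Finset.sum_add_distrib]
  refine (add_le_add
    (Finset.sum_le_sum fun u _ => sum_card_reachSet_sdiff_le hn u v hρ hb)
    (Finset.sum_le_sum fun u _ => sum_card_reachSet_sdiff_le hn v u hρ hb)).trans (le_of_eq ?_)
  simp only [Finset.sum_const, Finset.card_univ, Fintype.card_fin, nsmul_eq_mul]
  ring

/-- If few vertices reach fewer than `b` vertices, then a strongly connected closed set that is not
small has almost the same size as the set reachable from `v`. -/
lemma abs_card_sub_card_reachSet_lt {f : Fin n × Fin k → Fin n} {S : Finset (Fin n)}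
    (hS : ∀ u ∈ S, reachSet f u = S) (h6 : n < 6 * S.card) {b d : ℝ}
    (hfew : ∑ u, (if ((reachSet f u).card : ℝ) < b then (1 : ℝ) else 0) < n / 6) {v : Fin n}
    (hv : b ≤ (reachSet f v).card) (hd : 0 ≤ d) (hX : reachDiscrepancy b v f < d * (n / 6)) :
    |(S.card : ℝ) - (reachSet f v).card| < d := by
  have h6' : (n : ℝ) / 6 < S.card := by
    rw [div_lt_iff₀ (by norm_num)]
    exact_mod_cast (by omega : n < S.card * 6)
  have hb : b ≤ S.card := by
    by_contra hlt
    rw [not_le] at hlt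
    have : (S.card : ℝ) ≤ ∑ u, (if ((reachSet f u).card : ℝ) < b then (1 : ℝ) else 0) := by
      rw [Finset.sum_boole, Nat.cast_le]
      refine Finset.card_le_card fun u hu => ?_
      rw [Finset.mem_filter, hS u hu]
      exact ⟨Finset.mem_univ _, hlt⟩
    linarith
  have hle : (S.card : ℝ) * ((reachSet f v \ S).card + (S \ reachSet f v).card) ≤
      reachDiscrepancy b v f := by
    rw [← nsmul_eq_mul, ← Finset.sum_const]
    refine le_trans (Finset.sum_le_sum fun u hu => ?_)
      (Finset.sum_le_sum_of_subset_of_nonneg (Finset.subset_univ S)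
        fun u _ _ => reachDiscrepancy_summand_nonneg b u v f)
    rw [hS u hu, if_pos hb, if_pos hv]
  have h1 : (S.card : ℝ) + (reachSet f v \ S).card =
      (reachSet f v).card + (S \ reachSet f v).card := by
    have h2 := Finset.card_sdiff_add_card S (reachSet f v)
    have h3 := Finset.card_sdiff_add_card (reachSet f v) S
    rw [Finset.union_comm] at h3
    exact_mod_cast (by omega)
  by_contra hcon
  rw [not_lt] at hcon
  have h2 : d ≤ (reachSet f v \ S).card + (S \ reachSet f v).card := by
    refine hcon.trans (abs_le.2 ⟨?_, ?_⟩)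
    · have : (0 : ℝ) ≤ (S \ reachSet f v).card := by positivity
      linarith
    · have : (0 : ℝ) ≤ (reachSet f v \ S).card := by positivity
      linarith
  have h3 : d * (n / 6) ≤ S.card * ((reachSet f v \ S).card + (S \ reachSet f v).card) := by
    rw [mul_comm]
    gcongr
  linarith

lemma prob_le_sum_ite_card_reachSet_lt_le (hn : 0 < n) {a b r : ℝ} (ha : 0 < a)
    (hr : ∀ u, prob n k (fun f => ((reachSet f u).card : ℝ) < b) ≤ r) :
    prob n k (fun f => a ≤ ∑ u, (if ((reachSet f u).card : ℝ) < b then (1 : ℝ) else 0)) ≤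
      n * r / a := by
  refine prob_le_of_sum_le hn
    (fun f => ∑ u, (if ((reachSet f u).card : ℝ) < b then (1 : ℝ) else 0))
    (fun f => Finset.sum_nonneg fun u _ => by split_ifs <;> norm_num) ha (fun f hf => hf) ?_
  rw [Finset.sum_comm]
  have h : ∀ u : Fin n, ∑ f : Fin n × Fin k → Fin n,
      (if ((reachSet f u).card : ℝ) < b then (1 : ℝ) else 0) ≤
      r * Fintype.card (Fin n × Fin k → Fin n) := fun u => by
    rw [sum_ite_eq_prob hn]
    exact mul_le_mul_of_nonneg_right (hr u) (card_fun_pos hn).le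
  refine (Finset.sum_le_sum fun u _ => h u).trans (le_of_eq ?_)
  rw [Finset.sum_const, Finset.card_univ, Fintype.card_fin, nsmul_eq_mul, mul_assoc]

lemma prob_le_reachDiscrepancy_le (hn : 0 < n) (v : Fin n) {a b ρ : ℝ} (hρ : ρ < 1)
    (hb : k * (n - b) ≤ ρ * n) (ha : 0 < a) :
    prob n k (fun f => a ≤ reachDiscrepancy b v f) ≤ 2 * n / (1 - ρ) / a :=
  prob_le_of_sum_le hn (reachDiscrepancy b v)
    (fun f => Finset.sum_nonneg fun u _ => reachDiscrepancy_summand_nonneg b u v f) ha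
    (fun _ hf => hf) (sum_reachDiscrepancy_le hn v hρ hb)

/-- The size of the giant is close to the number of vertices reachable from `v`. -/
lemma prob_isGiant_and_le_abs_sub (hn : 0 < n) (hk : 2 ≤ k) (v : Fin n) {b d r ρ : ℝ}
    (hρ : ρ < 1) (hb : k * (n - b) ≤ ρ * n) (hd : 0 < d)
    (hr : ∀ u, prob n k (fun f => ((reachSet f u).card : ℝ) < b) ≤ r) :
    prob n k (fun f => ∃ G : Set (Fin n), IsGiant f G ∧
      d ≤ |(G.ncard : ℝ) - (reachSet f v).card|) ≤ 12 / n + 7 * r + 12 / (1 - ρ) / d := by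
  have hn' : (0 : ℝ) < n := by positivity
  have hfew := prob_le_sum_ite_card_reachSet_lt_le hn (a := (n : ℝ) / 6) (by positivity) hr
  have hdis := prob_le_reachDiscrepancy_le hn v hρ hb (a := d * (n / 6)) (by positivity)
  have hsmall := prob_exists_small_isClosedSet_le hn hk
  have hor := prob_or_le.trans (add_le_add hsmall (prob_or_le.trans (add_le_add hfew
    (prob_or_le.trans (add_le_add (hr v) hdis)))))
  refine (prob_mono ?_).trans (hor.trans (le_of_eq ?_))
  · rintro f ⟨G, hG, hGd⟩
    by_contra hcon
    rw [not_or, not_or, not_or, not_le, not_lt, not_le] at hcon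
    obtain ⟨h1, h2, h3, h4⟩ := hcon
    obtain ⟨S, rfl, hSne, hS⟩ := hG.exists_eq_reachSet
    rw [Set.ncard_coe_finset] at hGd
    refine absurd (abs_card_sub_card_reachSet_lt hS ?_ h2 h3 hd.le h4) (not_lt.2 hGd)
    by_contra h6
    exact h1 ⟨S, hSne, not_lt.1 h6, hG.1⟩
  · have : 1 - ρ ≠ 0 := by linarith
    field_simp
    ring

end Comparison

section Limit

lemma tendsto_stdNormalCDF_atBot : Tendsto stdNormalCDF atBot (nhds 0) := by
  have h := ProbabilityTheory.tendsto_cdf_atBot (ProbabilityTheory.gaussianReal 0 1)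
  refine h.congr fun x => ?_
  rw [ProbabilityTheory.cdf_eq_real, stdNormalCDF_eq_gaussianReal]

variable {k : ℕ} {τ : ℝ}

lemma tendsto_prob_card_reachSet_lt (hk : 2 ≤ k) (hτpos : 0 < τ)
    (hτ : 1 - τ / k - Real.exp (-τ) = 0) (u : ∀ n, Fin (n + 1)) {ε : ℝ} (hε : 0 < ε) :
    Tendsto (fun n => prob (n + 1) k (fun f =>
      ((reachSet f (u n)).card : ℝ) < (τ / k - ε) * ((n + 1 : ℕ) : ℝ))) atTop (nhds 0) := by
  have hκ : 0 < 1 - k * Real.exp (-τ) :=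
    sub_pos.2 (mul_exp_neg_lt_one (by omega) hτpos hτ)
  have hw : 0 < √(occupancyVar τ) := Real.sqrt_pos.2 (occupancyVar_pos hτpos)
  refine tendsto_order.2 ⟨fun a ha => Eventually.of_forall fun n => ha.trans_le (prob_nonneg),
    fun a ha => ?_⟩
  obtain ⟨y, hy⟩ := (tendsto_stdNormalCDF_atBot.eventually_lt_const ha).exists
  have hc := tendsto_prob_card_reachSet_le hk hτpos hτ u
    (y * √(occupancyVar τ) / (1 - k * Real.exp (-τ)))
  rw [div_mul_cancel₀ _ hκ.ne', mul_div_cancel_right₀ _ hw.ne'] at hc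
  filter_upwards [hc.eventually_lt_const hy, eventually_linear_add_sqrt_nonneg hε
    (y * √(occupancyVar τ) / (1 - k * Real.exp (-τ)))] with n h1 h2
  refine (prob_mono fun f hf => ?_).trans_lt h1
  linarith

lemma tendsto_prob_isGiant_and_le_abs_sub (hk : 2 ≤ k) (hτpos : 0 < τ)
    (hτ : 1 - τ / k - Real.exp (-τ) = 0) (v : ∀ n, Fin (n + 1)) {δ : ℝ} (hδ : 0 < δ) :
    Tendsto (fun n => prob (n + 1) k (fun f => ∃ G : Set (Fin (n + 1)), IsGiant f G ∧
      δ * √((n + 1 : ℕ) : ℝ) ≤ |(G.ncard : ℝ) - (reachSet f (v n)).card|)) atTop (nhds 0) := by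
  have hk0 : (0 : ℝ) < k := by positivity
  have hκ : k * Real.exp (-τ) < 1 := mul_exp_neg_lt_one (by omega) hτpos hτ
  set ε : ℝ := (1 - k * Real.exp (-τ)) / (2 * k) with hεdef
  have hε : 0 < ε := div_pos (by linarith) (by linarith)
  set ρ : ℝ := (1 + k * Real.exp (-τ)) / 2 with hρdef
  have hρ : ρ < 1 := by linarith
  have hu : ∀ n, ∃ u : Fin (n + 1), ∀ w, prob (n + 1) k (fun f =>
      ((reachSet f w).card : ℝ) < (τ / k - ε) * ((n + 1 : ℕ) : ℝ)) ≤ prob (n + 1) k (fun f =>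
      ((reachSet f u).card : ℝ) < (τ / k - ε) * ((n + 1 : ℕ) : ℝ)) := fun n => by
    obtain ⟨u, -, hu⟩ := Finset.exists_max_image Finset.univ (fun w : Fin (n + 1) =>
      prob (n + 1) k (fun f => ((reachSet f w).card : ℝ) < (τ / k - ε) * ((n + 1 : ℕ) : ℝ)))
      Finset.univ_nonempty
    exact ⟨u, fun w => hu w (Finset.mem_univ w)⟩
  choose u hu using hu
  have hkτ : k * (1 - (τ / k - ε)) = ρ := by
    have h1 : τ / k = 1 - Real.exp (-τ) := by linarith
    rw [h1, hεdef, hρdef]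
    field_simp
    ring
  have hlim : Tendsto (fun n : ℕ => 12 / ((n + 1 : ℕ) : ℝ) + 7 * prob (n + 1) k (fun f =>
      ((reachSet f (u n)).card : ℝ) < (τ / k - ε) * ((n + 1 : ℕ) : ℝ)) +
      12 / (1 - ρ) / (δ * √((n + 1 : ℕ) : ℝ))) atTop (nhds (0 + 7 * 0 + 0)) :=
    ((tendsto_const_div_succ 12).add
      ((tendsto_prob_card_reachSet_lt hk hτpos hτ u hε).const_mul 7)).add
      ((tendsto_sqrt_succ_atTop.const_mul_atTop hδ).const_div_atTop _)
  rw [mul_zero, add_zero, add_zero] at hlim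
  refine tendsto_of_tendsto_of_tendsto_of_le_of_le tendsto_const_nhds hlim
    (fun n => prob_nonneg) fun n => ?_
  refine prob_isGiant_and_le_abs_sub (Nat.succ_pos n) hk (v n) hρ (le_of_eq ?_)
    (mul_pos hδ (Real.sqrt_pos.2 (by positivity))) (hu n)
  rw [← hkτ]
  ring

/-- The distribution function of the size of the giant, centred and divided by the square root of
the number of vertices, converges. -/
lemma tendsto_prob_ncard_isGiant_le (hk : 2 ≤ k) (hτpos : 0 < τ)
    (hτ : 1 - τ / k - Real.exp (-τ) = 0) (c : ℝ) :
    Tendsto (fun n => prob (n + 1) k (fun f => ∃ G : Set (Fin (n + 1)), IsGiant f G ∧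
      (G.ncard : ℝ) ≤ τ / k * ((n + 1 : ℕ) : ℝ) + c * √((n + 1 : ℕ) : ℝ))) atTop
      (nhds (stdNormalCDF (c * (1 - k * Real.exp (-τ)) / √(occupancyVar τ)))) := by
  have hcont : Continuous fun c : ℝ =>
      stdNormalCDF (c * (1 - k * Real.exp (-τ)) / √(occupancyVar τ)) :=
    continuous_stdNormalCDF.comp (by fun_prop)
  have hreach := tendsto_prob_card_reachSet_le hk hτpos hτ fun n => (0 : Fin (n + 1))
  have hbad := fun δ hδ =>
    tendsto_prob_isGiant_and_le_abs_sub hk hτpos hτ (fun n => (0 : Fin (n + 1))) (δ := δ) hδ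
  have hlow : Tendsto (fun δ : ℝ => stdNormalCDF
      ((c - δ) * (1 - k * Real.exp (-τ)) / √(occupancyVar τ))) (nhdsWithin 0 (Set.Ioi 0))
      (nhds (stdNormalCDF (c * (1 - k * Real.exp (-τ)) / √(occupancyVar τ)))) := by
    have := (hcont.comp (continuous_const.sub continuous_id)).tendsto (f := fun δ : ℝ =>
      stdNormalCDF ((c - δ) * (1 - k * Real.exp (-τ)) / √(occupancyVar τ))) 0
    simp only [sub_zero] at this
    exact this.mono_left nhdsWithin_le_nhds
  have hupp : Tendsto (fun δ : ℝ => stdNormalCDF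
      ((c + δ) * (1 - k * Real.exp (-τ)) / √(occupancyVar τ))) (nhdsWithin 0 (Set.Ioi 0))
      (nhds (stdNormalCDF (c * (1 - k * Real.exp (-τ)) / √(occupancyVar τ)))) := by
    have := (hcont.comp (continuous_const.add continuous_id)).tendsto (f := fun δ : ℝ =>
      stdNormalCDF ((c + δ) * (1 - k * Real.exp (-τ)) / √(occupancyVar τ))) 0
    simp only [add_zero] at this
    exact this.mono_left nhdsWithin_le_nhds
  refine tendsto_of_forall_eventually_le hlow hupp
    (fun δ hδ => by simpa only [sub_zero] using (hreach (c - δ)).sub (hbad δ hδ))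
    (fun δ hδ => by simpa only [add_zero] using (hreach (c + δ)).add (hbad δ hδ))
    (fun δ hδ => Eventually.of_forall fun n => ?_) (fun δ hδ => Eventually.of_forall fun n => ?_)
  · rw [sub_le_iff_le_add]
    refine (prob_mono fun f hf => ?_).trans prob_or_le
    obtain ⟨G, hG⟩ := exists_isGiant (Nat.succ_pos n) f
    by_cases h : δ * √((n + 1 : ℕ) : ℝ) ≤ |(G.ncard : ℝ) - (reachSet f (0 : Fin (n + 1))).card|
    · exact Or.inr ⟨G, hG, h⟩
    · have := (abs_lt.1 (not_le.1 h)).2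
      exact Or.inl ⟨G, hG, by linarith⟩
  · refine (prob_mono ?_).trans prob_or_le
    rintro f ⟨G, hG, hle⟩
    by_cases h : δ * √((n + 1 : ℕ) : ℝ) ≤ |(G.ncard : ℝ) - (reachSet f (0 : Fin (n + 1))).card|
    · exact Or.inr ⟨G, hG, h⟩
    · have := (abs_lt.1 (not_le.1 h)).1
      exact Or.inl (by linarith)

end Limit

/-- Central limit law for the size of the giant of `𝒟_{n,k}`:
`(|𝒢_n| - ν_k n)/(σ_k √n)` converges in distribution to a standard normal. -/
theorem giant_clt (k : ℕ) (hk : 2 ≤ k) (τ : ℝ) (hτpos : 0 < τ)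
    (hτ : 1 - τ / k - Real.exp (-τ) = 0) (x : ℝ) :
    Filter.Tendsto (fun n : ℕ =>
      prob n k (fun f => ∃ G : Set (Fin n), IsGiant f G ∧
        ((G.ncard : ℝ) - (τ / k) * n) /
          (Real.sqrt (τ / (k * Real.exp τ * (1 - k * Real.exp (-τ)))) * Real.sqrt n) ≤ x))
      Filter.atTop
      (nhds ((Real.sqrt (2 * Real.pi))⁻¹ * ∫ t in Set.Iic x, Real.exp (-t ^ 2 / 2))) := by
  have hk0 : (0 : ℝ) < k := by positivity
  have hκ : 0 < 1 - k * Real.exp (-τ) :=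
    sub_pos.2 (mul_exp_neg_lt_one (by omega) hτpos hτ)
  have hw : 0 < √(occupancyVar τ) := Real.sqrt_pos.2 (occupancyVar_pos hτpos)
  have hσ : 0 < √(τ / (k * Real.exp τ * (1 - k * Real.exp (-τ)))) :=
    Real.sqrt_pos.2 (by positivity)
  have hσκ := sqrt_mul_eq_sqrt_occupancyVar (by omega) hτpos hτ
  set σ : ℝ := √(τ / (k * Real.exp τ * (1 - k * Real.exp (-τ))))
  rw [← tendsto_add_atTop_iff_nat 1]
  have h := tendsto_prob_ncard_isGiant_le hk hτpos hτ (x * σ)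
  rw [mul_assoc, hσκ, mul_div_cancel_right₀ _ hw.ne'] at h
  refine h.congr fun n => ?_
  have hN : 0 < √((n + 1 : ℕ) : ℝ) := Real.sqrt_pos.2 (by positivity)
  simp only [div_le_iff₀ (mul_pos hσ hN), sub_le_iff_le_add', mul_assoc]
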